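/- arXiv:1808.02236 — 3 statements merged into one kernel-verified Lean document; each statement's English description precedes it below -/
import Mathlib

section
/- Let d ≥ 3, let a > -((d-2)/2)², and let 1 < p < (d+2)/(d-2). Define, for nonzero radial f ∈ C_c^∞(ℝ^d \ {0}) complex-valued, the functional J_a(f) = (∫_{ℝ^d} |f|^{p+1} dx) / [ (∫_{ℝ^d} |f|² dx)^{(d+2-(d-2)p)/4} · (∫_{ℝ^d} (|∇f(x)|² + a|f(x)|²/|x|²) dx)^{d(p-1)/4} ]. Then the supremum C_a of J_a(f) over all nonzero radial f ∈ C_c^∞(ℝ^d \ {0}) satisfies 0 < C_a < ∞; in particular the Gagliardo–Nirenberg inequality ∫ |f|^{p+1} dx ≤ C_a (∫ |f|² dx)^{(d+2-(d-2)p)/4} (∫ (|∇f|² + a|f|²/|x|²) dx)^{d(p-1)/4} holds for all radial f ∈ C_c^∞(ℝ^d \ {0}). -/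
open MeasureTheory Set

/-- The pointwise squared gradient `|∇f(x)|² = ∑_j |∂_j f(x)|²` of a function
`f : ℝ^d → ℂ`. -/
noncomputable def gradNormSq (d : ℕ) (f : EuclideanSpace ℝ (Fin d) → ℂ)
    (x : EuclideanSpace ℝ (Fin d)) : ℝ :=
  ∑ j : Fin d, ‖fderiv ℝ f x (EuclideanSpace.single j 1)‖ ^ 2

lemma gn_contDiff_mul {d : ℕ} {f : EuclideanSpace ℝ (Fin d) → ℂ}
    (hf : ContDiff ℝ (⊤ : ℕ∞) f) (h0 : (0 : EuclideanSpace ℝ (Fin d)) ∉ tsupport f)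
    {h : EuclideanSpace ℝ (Fin d) → ℝ} (hh : ∀ x, x ≠ 0 → ContDiffAt ℝ (⊤ : ℕ∞) h x) :
    ContDiff ℝ (⊤ : ℕ∞) (fun x => h x * ‖f x‖ ^ 2) := by
  rw [contDiff_iff_contDiffAt]
  intro x
  by_cases hx : x = 0
  · subst hx
    have : (fun x => h x * ‖f x‖ ^ 2) =ᶠ[nhds 0] fun _ => (0 : ℝ) := by
      filter_upwards [notMem_tsupport_iff_eventuallyEq.1 h0] with y hy
      simp [hy]
    exact contDiffAt_const.congr_of_eventuallyEq this
  · exact (hh x hx).mul (hf.norm_sq ℝ).contDiffAt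

lemma gn_compact_mul {d : ℕ} {f : EuclideanSpace ℝ (Fin d) → ℂ}
    (hc : HasCompactSupport f) (h : EuclideanSpace ℝ (Fin d) → ℝ) :
    HasCompactSupport (fun x => h x * ‖f x‖ ^ 2) := by
  apply hc.mono
  intro x hx
  simp only [Function.mem_support] at *
  intro h; simp [h] at hx

lemma gn_integral_deriv {d : ℕ} {g : EuclideanSpace ℝ (Fin d) → ℝ}
    (hg : ContDiff ℝ (⊤ : ℕ∞) g) (hc : HasCompactSupport g) (v : EuclideanSpace ℝ (Fin d)) :
    Integrable (fun x => fderiv ℝ g x v) ∧ ∫ x, fderiv ℝ g x v = 0 := by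
  have hi : Integrable (fun x => fderiv ℝ g x v) := by
    apply Continuous.integrable_of_hasCompactSupport
    · exact (hg.continuous_fderiv (by simp)).clm_apply continuous_const
    · exact hc.fderiv_apply (𝕜 := ℝ) v
  refine ⟨hi, ?_⟩
  have := integral_mul_fderiv_eq_neg_fderiv_mul_of_integrable
    (μ := (volume : Measure (EuclideanSpace ℝ (Fin d)))) (f := fun _ => (1 : ℝ)) (g := g) (v := v)
    (by simp) (by simpa using hi)
    (by simpa using hg.continuous.integrable_of_hasCompactSupport hc)
    (fun x _ => differentiableAt_const _)
    (fun x _ => (hg.differentiable (by simp)) x)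
  simpa using this

lemma gn_pointwise_deriv {d : ℕ} {f : EuclideanSpace ℝ (Fin d) → ℂ}
    (hf : ContDiff ℝ (⊤ : ℕ∞) f) (x : EuclideanSpace ℝ (Fin d)) (hx : x ≠ 0) (j : Fin d) :
    fderiv ℝ (fun x => (x j / ‖x‖ ^ 2) * ‖f x‖ ^ 2) x (EuclideanSpace.single j 1) =
      (1 / ‖x‖ ^ 2 - 2 * x j ^ 2 / (‖x‖ ^ 2) ^ 2) * ‖f x‖ ^ 2 +
      (x j / ‖x‖ ^ 2) * (2 * inner ℝ (f x) (fderiv ℝ f x (EuclideanSpace.single j 1))) := by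
  have hx2 : ‖x‖ ^ 2 ≠ 0 := by simpa using hx
  have h1 : HasFDerivAt (fun x : EuclideanSpace ℝ (Fin d) => x j)
      (EuclideanSpace.proj j : EuclideanSpace ℝ (Fin d) →L[ℝ] ℝ) x :=
    (EuclideanSpace.proj j : EuclideanSpace ℝ (Fin d) →L[ℝ] ℝ).hasFDerivAt
  have h2 := (hasFDerivAt_id (𝕜 := ℝ) x).norm_sq
  have h3 := ((hf.differentiable (by simp)) x).hasFDerivAt.norm_sq
  have h4 := (h1.mul ((hasDerivAt_inv hx2).comp_hasFDerivAt x h2)).mul h3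
  have h5 : (fun x : EuclideanSpace ℝ (Fin d) => (x j / ‖x‖ ^ 2) * ‖f x‖ ^ 2) =
    ((fun x : EuclideanSpace ℝ (Fin d) => x j) * (Inv.inv ∘ fun x => ‖id x‖ ^ 2))
      * fun x => ‖f x‖ ^ 2 := by
    ext y; simp [div_eq_mul_inv]
  rw [h5, h4.fderiv]
  have h6 : inner ℝ x (EuclideanSpace.single j (1:ℝ)) = x j := by
    rw [EuclideanSpace.inner_single_right]; simp
  simp [h6]
  field_simp
  ring

lemma gn_hardy {d : ℕ} (l : ℝ) {f : EuclideanSpace ℝ (Fin d) → ℂ}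
    (hf : ContDiff ℝ (⊤ : ℕ∞) f) (hc : HasCompactSupport f)
    (h0 : (0 : EuclideanSpace ℝ (Fin d)) ∉ tsupport f) :
    Integrable (fun x => ‖f x‖ ^ 2 / ‖x‖ ^ 2) ∧ Integrable (gradNormSq d f) ∧
    (l * ((d : ℝ) - 2) - l ^ 2) * ∫ x, ‖f x‖ ^ 2 / ‖x‖ ^ 2 ≤ ∫ x, gradNormSq d f x := by
  have hr : Integrable (fun x => ‖f x‖ ^ 2 / ‖x‖ ^ 2) := by
    have h1 : ContDiff ℝ (⊤ : ℕ∞)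
        (fun x : EuclideanSpace ℝ (Fin d) => (‖x‖ ^ 2)⁻¹ * ‖f x‖ ^ 2) := by
      refine gn_contDiff_mul hf h0 fun x hx => ?_
      exact (contDiff_id.norm_sq ℝ).contDiffAt.inv (by simpa using hx)
    have := h1.continuous.integrable_of_hasCompactSupport (μ := volume)
      (gn_compact_mul hc fun x => (‖x‖ ^ 2)⁻¹)
    simpa only [div_eq_inv_mul] using this
  have hG : Integrable (gradNormSq d f) := by
    unfold gradNormSq
    refine integrable_finsetSum _ fun j _ => ?_
    apply Continuous.integrable_of_hasCompactSupport
    · exact ((hf.continuous_fderiv (by simp)).clm_apply continuous_const).norm.pow 2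
    · refine (hc.fderiv_apply (𝕜 := ℝ) (EuclideanSpace.single j 1)).mono fun x hx => ?_
      simp only [Function.mem_support] at *
      intro h; simp [h] at hx
  refine ⟨hr, hG, ?_⟩
  have hg (j : Fin d) := gn_integral_deriv
    (gn_contDiff_mul hf h0 (h := fun x => x j / ‖x‖ ^ 2) (fun x hx => by
      refine ContDiffAt.div ?_ (contDiff_id.norm_sq ℝ).contDiffAt (by simpa using hx)
      exact (EuclideanSpace.proj j : EuclideanSpace ℝ (Fin d) →L[ℝ] ℝ).contDiff.contDiffAt))
    (gn_compact_mul hc fun x => x j / ‖x‖ ^ 2) (EuclideanSpace.single j 1)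
  set D : Fin d → EuclideanSpace ℝ (Fin d) → ℝ := fun j x =>
    fderiv ℝ (fun x => (x j / ‖x‖ ^ 2) * ‖f x‖ ^ 2) x (EuclideanSpace.single j 1) with hD
  have hDi : Integrable (fun x => ∑ j, D j x) := integrable_finsetSum _ fun j _ => (hg j).1
  have hD0 : ∫ x, ∑ j, D j x = 0 := by
    rw [integral_finsetSum _ fun j _ => (hg j).1]
    exact Finset.sum_eq_zero fun j _ => (hg j).2
  have key : ∀ x, (l * ((d : ℝ) - 2) - l ^ 2) * (‖f x‖ ^ 2 / ‖x‖ ^ 2) ≤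
      gradNormSq d f x + l * ∑ j, D j x := by
    intro x
    by_cases hx : x = 0
    · subst hx
      have hz : ∀ j, D j 0 = 0 := by
        intro j
        have : (fun x : EuclideanSpace ℝ (Fin d) => x j / ‖x‖ ^ 2 * ‖f x‖ ^ 2)
            =ᶠ[nhds 0] fun _ => (0 : ℝ) := by
          filter_upwards [notMem_tsupport_iff_eventuallyEq.1 h0] with y hy
          simp [hy]
        simp only [hD]
        rw [this.fderiv_eq]; simp
      simp only [hz, norm_zero]
      simp only [gradNormSq, Finset.sum_const_zero]
      norm_num
      positivity
    · have hx2 : ‖x‖ ^ 2 ≠ 0 := by simpa using hx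
      have hsum : ∑ j, x j ^ 2 = ‖x‖ ^ 2 := by
        rw [EuclideanSpace.norm_sq_eq]; simp
      have hpos : 0 ≤ ∑ j : Fin d,
          ‖fderiv ℝ f x (EuclideanSpace.single j 1) + (l * (x j / ‖x‖ ^ 2)) • f x‖ ^ 2 := by
        positivity
      have hexp : ∑ j : Fin d,
          ‖fderiv ℝ f x (EuclideanSpace.single j 1) + (l * (x j / ‖x‖ ^ 2)) • f x‖ ^ 2
          = gradNormSq d f x + l * ∑ j, D j x -
            (l * ((d : ℝ) - 2) - l ^ 2) * (‖f x‖ ^ 2 / ‖x‖ ^ 2) := by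
        have h1 : ∀ j : Fin d,
          ‖fderiv ℝ f x (EuclideanSpace.single j 1) + (l * (x j / ‖x‖ ^ 2)) • f x‖ ^ 2
          = ‖fderiv ℝ f x (EuclideanSpace.single j 1)‖ ^ 2 + l * D j x
            - l * (‖f x‖ ^ 2 / ‖x‖ ^ 2) +
            ((2 * l + l ^ 2) * ‖f x‖ ^ 2 / (‖x‖ ^ 2) ^ 2) * x j ^ 2 := by
          intro j
          simp only [hD]
          rw [gn_pointwise_deriv hf x hx j, norm_add_sq_real, norm_smul, mul_pow, Real.norm_eq_abs,
            sq_abs, inner_smul_right, real_inner_comm]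
          field_simp
          ring
        rw [Finset.sum_congr rfl fun j _ => h1 j]
        rw [Finset.sum_add_distrib, Finset.sum_sub_distrib, Finset.sum_add_distrib,
          ← Finset.mul_sum, ← Finset.mul_sum, ← Finset.mul_sum, hsum]
        simp only [Finset.sum_const, Finset.card_univ, Fintype.card_fin, nsmul_eq_mul]
        unfold gradNormSq
        field_simp
        ring
      linarith
  have := integral_mono (hr.const_mul (l * ((d : ℝ) - 2) - l ^ 2)) (hG.add (hDi.const_mul l)) key
  simp only [Pi.add_apply] at this
  rw [integral_const_mul, integral_add hG (hDi.const_mul l), integral_const_mul, hD0] at this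
  simpa using this

lemma gn_fderiv_le {d : ℕ} (f : EuclideanSpace ℝ (Fin d) → ℂ) (x : EuclideanSpace ℝ (Fin d)) :
    ‖fderiv ℝ f x‖ ^ 2 ≤ gradNormSq d f x := by
  have hnn : 0 ≤ gradNormSq d f x := by unfold gradNormSq; positivity
  rw [← Real.le_sqrt (norm_nonneg _) hnn]
  refine ContinuousLinearMap.opNorm_le_bound _ (Real.sqrt_nonneg _) fun v => ?_
  have hv : v = ∑ j, v j • EuclideanSpace.single j (1:ℝ) := by
    ext i
    simp [Finset.sum_apply, Pi.single_apply]
  conv_lhs => rw [hv, map_sum]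
  refine (norm_sum_le _ _).trans ?_
  have := Real.sum_mul_le_sqrt_mul_sqrt Finset.univ
    (fun j => ‖fderiv ℝ f x (EuclideanSpace.single j 1)‖) (fun j => ‖v j‖)
  rw [EuclideanSpace.norm_eq]
  refine le_trans (le_of_eq ?_) this
  refine Finset.sum_congr rfl fun j _ => ?_
  rw [map_smul, norm_smul, mul_comm]

/-- Sobolev inequality in Bochner-integral form. -/
lemma gn_sobolev (d : ℕ) (hd : 3 ≤ d) : ∃ S : ℝ, 0 < S ∧ ∀ f : EuclideanSpace ℝ (Fin d) → ℂ,
    ContDiff ℝ (⊤ : ℕ∞) f → HasCompactSupport f → Integrable (gradNormSq d f) →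
    (∫ x, ‖f x‖ ^ (2 * (d : ℝ) / ((d : ℝ) - 2))) ≤
      S * (∫ x, gradNormSq d f x) ^ ((d : ℝ) / ((d : ℝ) - 2)) := by
  have hd3 : (3 : ℝ) ≤ d := by exact_mod_cast hd
  have hd2 : (0 : ℝ) < d - 2 := by linarith
  set q : ℝ := 2 * (d : ℝ) / ((d : ℝ) - 2) with hq
  have hq0 : 0 < q := by positivity
  set K : ℝ := (SNormLESNormFDerivOfEqConst ℂ
    (volume : Measure (EuclideanSpace ℝ (Fin d))) 2 : ℝ) with hK
  have hK0 : 0 ≤ K := by positivity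
  refine ⟨(K + 1) ^ q, by positivity, fun f hf hc hG => ?_⟩
  have hmf : ∀ r : ENNReal, MemLp f r := fun r => hf.continuous.memLp_of_hasCompactSupport hc
  have hmd : MemLp (fderiv ℝ f) 2 :=
    (hf.continuous_fderiv (by simp)).memLp_of_hasCompactSupport (hc.fderiv ℝ)
  have h := eLpNorm_le_eLpNorm_fderiv_of_eq
    (volume : Measure (EuclideanSpace ℝ (Fin d))) (F := ℂ) (u := f) (hf.of_le (by simp)) hc
    (p := 2) (p' := q.toNNReal) (by norm_num) (by simp; omega)
    (by
      rw [Real.coe_toNNReal _ hq0.le, hq]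
      simp only [finrank_euclideanSpace, Fintype.card_fin]
      push_cast
      field_simp)
  rw [(hmf _).eLpNorm_eq_integral_rpow_norm (by simpa using hq0) (by simp)] at h
  have h2 : ((2 : NNReal) : ENNReal) = 2 := by norm_num
  rw [h2, hmd.eLpNorm_eq_integral_rpow_norm (by simp) (by simp)] at h
  simp only [ENNReal.coe_toReal, Real.coe_toNNReal _ hq0.le, ENNReal.toReal_ofNat] at h
  rw [← ENNReal.ofReal_coe_nnreal, ← ENNReal.ofReal_mul (by positivity),
    ENNReal.ofReal_le_ofReal_iff (by positivity)] at h
  simp only [NNReal.coe_ofNat] at h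
  rw [← hK] at h
  have hmono : ∫ x, ‖fderiv ℝ f x‖ ^ (2 : ℝ) ≤ ∫ x, gradNormSq d f x := by
    refine integral_mono_of_nonneg (Filter.Eventually.of_forall fun x => by positivity) hG
      (Filter.Eventually.of_forall fun x => ?_)
    simpa using gn_fderiv_le f x
  have hI0 : 0 ≤ ∫ x, ‖f x‖ ^ q := integral_nonneg fun x => by positivity
  have hI1 : 0 ≤ ∫ x, ‖fderiv ℝ f x‖ ^ (2 : ℝ) := integral_nonneg fun x => by positivity
  have hI2 := hI1.trans hmono
  have h3 : (∫ x, ‖f x‖ ^ q) ^ q⁻¹ ≤ (K + 1) * (∫ x, gradNormSq d f x) ^ (2 : ℝ)⁻¹ := by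
    refine h.trans ?_
    gcongr
    linarith
  have h4 := Real.rpow_le_rpow (by positivity) h3 hq0.le
  rw [Real.rpow_inv_rpow hI0 hq0.ne', Real.mul_rpow (by positivity) (by positivity),
    ← Real.rpow_mul hI2] at h4
  convert h4 using 3
  rw [hq]; field_simp

lemma gn_interp {d : ℕ} {f : EuclideanSpace ℝ (Fin d) → ℂ} (hf : Continuous f)
    (hc : HasCompactSupport f) {t q r : ℝ} (ht0 : 0 < t) (ht1 : t < 1) (hq : 0 < q)
    (hr : r = 2 * (1 - t) + q * t) :
    ∫ x, ‖f x‖ ^ r ≤ (∫ x, ‖f x‖ ^ 2) ^ (1 - t) * (∫ x, ‖f x‖ ^ q) ^ t := by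
  have ht2 : 0 < 1 - t := by linarith
  have hm : ∀ s : ℝ, 0 < s → ∀ b : ENNReal, MemLp (fun x => ‖f x‖ ^ s) b := by
    intro s hs b
    refine (hf.norm.rpow_const fun x => Or.inr hs.le).memLp_of_hasCompactSupport (hc.mono ?_)
    intro x hx
    simp only [Function.mem_support] at *
    intro h; simp [h, hs.ne'] at hx
  have hpq : (1 / (1 - t)).HolderConjugate (1 / t) := by
    rw [Real.holderConjugate_iff]
    refine ⟨by rw [lt_div_iff₀ ht2]; linarith, by field_simp; ring⟩
  have h := integral_mul_le_Lp_mul_Lq_of_nonneg (μ := volume) hpq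
    (f := fun x => ‖f x‖ ^ (2 * (1 - t))) (g := fun x => ‖f x‖ ^ (q * t))
    (Filter.Eventually.of_forall fun x => by positivity)
    (Filter.Eventually.of_forall fun x => by positivity)
    (hm _ (by positivity) _) (hm _ (by positivity) _)
  have e1 : ∀ x, (‖f x‖ ^ (2 * (1 - t))) ^ (1 / (1 - t)) = ‖f x‖ ^ 2 := fun x => by
    rw [← Real.rpow_mul (norm_nonneg _), ← Real.rpow_natCast]
    congr 1; push_cast; field_simp
  have e2 : ∀ x, (‖f x‖ ^ (q * t)) ^ (1 / t) = ‖f x‖ ^ q := fun x => by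
    rw [← Real.rpow_mul (norm_nonneg _)]
    congr 1; field_simp
  have e3 : ∀ x, ‖f x‖ ^ (2 * (1 - t)) * ‖f x‖ ^ (q * t) = ‖f x‖ ^ r := fun x => by
    rw [← Real.rpow_add_of_nonneg (norm_nonneg _) (by positivity) (by positivity), hr]
  simpa only [e1, e2, e3, one_div_one_div] using h

lemma gn_exists_radial (d : ℕ) (hd : 3 ≤ d) : ∃ f : EuclideanSpace ℝ (Fin d) → ℂ,
    ContDiff ℝ (⊤ : ℕ∞) f ∧ HasCompactSupport f ∧
    (0 : EuclideanSpace ℝ (Fin d)) ∉ tsupport f ∧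
    (∀ x y, ‖x‖ = ‖y‖ → f x = f y) ∧ f ≠ 0 := by
  let b : ContDiffBump (2 : ℝ) := ⟨1 / 2, 1, by norm_num, by norm_num⟩
  let f : EuclideanSpace ℝ (Fin d) → ℂ := fun x => ((b (‖x‖ ^ 2) : ℝ) : ℂ)
  have hz : ∀ x : EuclideanSpace ℝ (Fin d), 1 ≤ |‖x‖ ^ 2 - 2| → f x = 0 := by
    intro x hx
    simp only [f]
    rw [b.zero_of_le_dist (by simpa [Real.dist_eq] using hx)]
    simp
  refine ⟨f, ?_, ?_, ?_, ?_, ?_⟩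
  · exact Complex.ofRealCLM.contDiff.comp (b.contDiff.comp (contDiff_id.norm_sq ℝ))
  · refine HasCompactSupport.of_support_subset_isCompact
      (isCompact_closedBall (0 : EuclideanSpace ℝ (Fin d)) 2) fun x hx => ?_
    by_contra hn
    simp only [Metric.mem_closedBall, dist_zero_right, not_le] at hn
    refine hx (hz x ?_)
    rw [le_abs]; left; nlinarith
  · rw [notMem_tsupport_iff_eventuallyEq]
    filter_upwards [Metric.ball_mem_nhds (0 : EuclideanSpace ℝ (Fin d)) one_pos] with x hx
    simp only [Metric.mem_ball, dist_zero_right] at hx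
    refine hz x ?_
    rw [le_abs]; right; nlinarith [norm_nonneg x]
  · intro x y hxy
    simp only [f, hxy]
  · intro h
    have h1 := congrFun h (EuclideanSpace.single (⟨0, by omega⟩ : Fin d) (Real.sqrt 2))
    simp only [f, EuclideanSpace.norm_single, Real.norm_eq_abs, sq_abs] at h1
    rw [Real.sq_sqrt (by norm_num), b.one_of_mem_closedBall (by simp [b])] at h1
    simp at h1

lemma gn_bound (d : ℕ) (hd : 3 ≤ d) (a : ℝ)
    (ha : -((((d : ℝ) - 2) / 2) ^ 2) < a) (p : ℝ) (hp₁ : 1 < p)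
    (hp₂ : p < ((d : ℝ) + 2) / ((d : ℝ) - 2)) :
    ∃ B : ℝ, ∀ f : EuclideanSpace ℝ (Fin d) → ℂ,
        ContDiff ℝ (⊤ : ℕ∞) f → HasCompactSupport f →
        (0 : EuclideanSpace ℝ (Fin d)) ∉ tsupport f →
        0 ≤ (∫ x, (gradNormSq d f x + a * ‖f x‖ ^ 2 / ‖x‖ ^ 2)) ∧
        (∫ x, ‖f x‖ ^ (p + 1)) ≤
          B * ((∫ x, ‖f x‖ ^ 2) ^ (((d : ℝ) + 2 - ((d : ℝ) - 2) * p) / 4) *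
              (∫ x, (gradNormSq d f x + a * ‖f x‖ ^ 2 / ‖x‖ ^ 2)) ^
                ((d : ℝ) * (p - 1) / 4)) := by
  have hd3 : (3 : ℝ) ≤ d := by exact_mod_cast hd
  have hd2 : (0 : ℝ) < d - 2 := by linarith
  obtain ⟨S, hS, hsob⟩ := gn_sobolev d hd
  set h : ℝ := (((d : ℝ) - 2) / 2) ^ 2 with hh
  have hh0 : 0 < h := by positivity
  obtain ⟨c, hc0, hc1, hca⟩ : ∃ c : ℝ, 0 < c ∧ c ≤ 1 ∧ (c - 1) * h ≤ a := by
    refine ⟨min 1 (1 + a / h), ?_, min_le_left _ _, ?_⟩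
    · refine lt_min one_pos ?_
      have : -1 < a / h := by rw [lt_div_iff₀ hh0]; linarith
      linarith
    · have h1 := min_le_right (1 : ℝ) (1 + a / h)
      calc (min 1 (1 + a / h) - 1) * h ≤ (a / h) * h := by gcongr; linarith
        _ = a := by field_simp
  set t : ℝ := (p - 1) * (d - 2) / 4 with ht
  set β : ℝ := (d : ℝ) * (p - 1) / 4 with hβ
  have hp3 : 0 < p - 1 := by linarith
  have hβ0 : 0 < β := by positivity
  have ht0 : 0 < t := by positivity
  have ht1 : t < 1 := by
    rw [lt_div_iff₀ hd2] at hp₂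
    rw [ht]; linarith
  have h1t : ((d : ℝ) + 2 - ((d : ℝ) - 2) * p) / 4 = 1 - t := by rw [ht]; ring
  refine ⟨S ^ t * (c⁻¹) ^ β, fun f hf hc h0 => ?_⟩
  obtain ⟨hr, hG, hhardy⟩ := gn_hardy (((d : ℝ) - 2) / 2) hf hc h0
  have hhl : ((d : ℝ) - 2) / 2 * ((d : ℝ) - 2) - (((d : ℝ) - 2) / 2) ^ 2 = h := by rw [hh]; ring
  rw [hhl] at hhardy
  have hA : ∫ x, (gradNormSq d f x + a * ‖f x‖ ^ 2 / ‖x‖ ^ 2) =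
      (∫ x, gradNormSq d f x) + a * ∫ x, ‖f x‖ ^ 2 / ‖x‖ ^ 2 := by
    simp only [mul_div_assoc]
    rw [integral_add hG (hr.const_mul a), integral_const_mul]
  have hH0 : 0 ≤ ∫ x, ‖f x‖ ^ 2 / ‖x‖ ^ 2 := integral_nonneg fun x => by positivity
  have hG0 : 0 ≤ ∫ x, gradNormSq d f x :=
    integral_nonneg fun x => by unfold gradNormSq; positivity
  have hM0 : 0 ≤ ∫ x, ‖f x‖ ^ 2 := integral_nonneg fun x => by positivity
  rw [hA, h1t]
  set G := ∫ x, gradNormSq d f x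
  set H := ∫ x, ‖f x‖ ^ 2 / ‖x‖ ^ 2
  have hcG : c * G ≤ G + a * H := by
    have h1 : (c - 1) * h * H ≤ a * H := by gcongr
    have h2 : (1 - c) * (h * H) ≤ (1 - c) * G :=
      mul_le_mul_of_nonneg_left hhardy (by linarith)
    linarith
  have hA0 : 0 ≤ G + a * H := le_trans (by positivity) hcG
  refine ⟨hA0, ?_⟩
  have hint := gn_interp hf.continuous hc ht0 ht1
    (q := 2 * (d : ℝ) / ((d : ℝ) - 2)) (r := p + 1) (by positivity)
    (by rw [ht]; field_simp; ring)
  have hs := hsob f hf hc hG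
  have hq0 : 0 ≤ ∫ x, ‖f x‖ ^ (2 * (d : ℝ) / ((d : ℝ) - 2)) :=
    integral_nonneg fun x => by positivity
  have hs2 := Real.rpow_le_rpow hq0 hs ht0.le
  rw [Real.mul_rpow hS.le (by positivity), ← Real.rpow_mul hG0] at hs2
  have he : (d : ℝ) / ((d : ℝ) - 2) * t = β := by rw [ht, hβ]; field_simp
  rw [he] at hs2
  have hGA : G ≤ c⁻¹ * (G + a * H) := by
    rw [inv_mul_eq_div, le_div_iff₀ hc0]; linarith
  have hs3 := Real.rpow_le_rpow hG0 hGA hβ0.le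
  rw [Real.mul_rpow (by positivity) hA0] at hs3
  calc _ ≤ _ := hint
    _ ≤ (∫ x, ‖f x‖ ^ 2) ^ (1 - t) * (S ^ t * (c⁻¹ ^ β * (G + a * H) ^ β)) := by
      gcongr
      exact hs2.trans (by gcongr)
    _ = _ := by ring

/-- Sharp Gagliardo–Nirenberg inequality with inverse-square potential (Theorem 3.1,
finiteness and positivity of the sharp constant): for `d ≥ 3`, `a > -((d-2)/2)²`,
`1 < p < (d+2)/(d-2)`, the supremum `C_a` of the Gagliardo–Nirenberg functional
`J_a(f)` over nonzero radial `f ∈ C_c^∞(ℝ^d \ {0})` satisfies `0 < C_a < ∞`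
(it is a real least upper bound), and the corresponding inequality holds. -/
theorem sharp_gagliardo_nirenberg (d : ℕ) (hd : 3 ≤ d) (a : ℝ)
    (ha : -((((d : ℝ) - 2) / 2) ^ 2) < a) (p : ℝ) (hp₁ : 1 < p)
    (hp₂ : p < ((d : ℝ) + 2) / ((d : ℝ) - 2)) :
    ∃ C : ℝ, 0 < C ∧
      IsLUB { J : ℝ | ∃ f : EuclideanSpace ℝ (Fin d) → ℂ,
          ContDiff ℝ (⊤ : ℕ∞) f ∧ HasCompactSupport f ∧
          (0 : EuclideanSpace ℝ (Fin d)) ∉ tsupport f ∧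
          (∀ x y, ‖x‖ = ‖y‖ → f x = f y) ∧ f ≠ 0 ∧
          J = (∫ x, ‖f x‖ ^ (p + 1)) /
              ((∫ x, ‖f x‖ ^ 2) ^ (((d : ℝ) + 2 - ((d : ℝ) - 2) * p) / 4) *
               (∫ x, (gradNormSq d f x + a * ‖f x‖ ^ 2 / ‖x‖ ^ 2)) ^
                 ((d : ℝ) * (p - 1) / 4)) } C ∧
      ∀ f : EuclideanSpace ℝ (Fin d) → ℂ,
        ContDiff ℝ (⊤ : ℕ∞) f → HasCompactSupport f →
        (0 : EuclideanSpace ℝ (Fin d)) ∉ tsupport f →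
        (∀ x y, ‖x‖ = ‖y‖ → f x = f y) →
        (∫ x, ‖f x‖ ^ (p + 1)) ≤
          C * (∫ x, ‖f x‖ ^ 2) ^ (((d : ℝ) + 2 - ((d : ℝ) - 2) * p) / 4) *
              (∫ x, (gradNormSq d f x + a * ‖f x‖ ^ 2 / ‖x‖ ^ 2)) ^
                ((d : ℝ) * (p - 1) / 4) := by
  obtain ⟨B, hB⟩ := gn_bound d hd a ha p hp₁ hp₂
  have hd3 : (3 : ℝ) ≤ d := by exact_mod_cast hd
  have hβ0 : 0 < (d : ℝ) * (p - 1) / 4 := by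
    have : 0 < p - 1 := by linarith
    positivity
  -- positivity of all the integrals for nonzero functions
  have hpos : ∀ f : EuclideanSpace ℝ (Fin d) → ℂ,
      ContDiff ℝ (⊤ : ℕ∞) f → HasCompactSupport f →
      (0 : EuclideanSpace ℝ (Fin d)) ∉ tsupport f → f ≠ 0 →
      0 < (∫ x, ‖f x‖ ^ (p + 1)) ∧ 0 < (∫ x, ‖f x‖ ^ 2) ∧
      0 < ∫ x, (gradNormSq d f x + a * ‖f x‖ ^ 2 / ‖x‖ ^ 2) := by
    intro f hf hc h0 hne
    obtain ⟨x₀, hx₀⟩ : ∃ x, f x ≠ 0 := by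
      by_contra hcon
      push Not at hcon
      exact hne (funext hcon)
    have hx₀' : 0 < ‖f x₀‖ := norm_pos_iff.2 hx₀
    have h1 : 0 < (∫ x, ‖f x‖ ^ (p + 1)) := by
      refine Continuous.integral_pos_of_hasCompactSupport_nonneg_nonzero
        (f := fun x => ‖f x‖ ^ (p + 1)) (x := x₀)
        (hf.continuous.norm.rpow_const fun x => Or.inr (by linarith)) (hc.mono ?_)
        (fun x => by positivity) (by positivity)
      intro x hx
      simp only [Function.mem_support] at *
      intro h
      rw [h, norm_zero, Real.zero_rpow (by linarith)] at hx
      exact hx rfl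
    have h2 : 0 < (∫ x, ‖f x‖ ^ 2) := by
      refine Continuous.integral_pos_of_hasCompactSupport_nonneg_nonzero
        (f := fun x => ‖f x‖ ^ 2) (x := x₀)
        (hf.continuous.norm.pow 2) (hc.mono ?_)
        (fun x => by positivity) (by positivity)
      intro x hx
      simp only [Function.mem_support] at *
      intro h
      simp [h] at hx
    refine ⟨h1, h2, ?_⟩
    obtain ⟨h3, h4⟩ := hB f hf hc h0
    refine lt_of_le_of_ne h3 fun h5 => ?_
    rw [← h5, Real.zero_rpow hβ0.ne', mul_zero, mul_zero] at h4
    linarith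
  set T : Set ℝ := { J : ℝ | ∃ f : EuclideanSpace ℝ (Fin d) → ℂ,
          ContDiff ℝ (⊤ : ℕ∞) f ∧ HasCompactSupport f ∧
          (0 : EuclideanSpace ℝ (Fin d)) ∉ tsupport f ∧
          (∀ x y, ‖x‖ = ‖y‖ → f x = f y) ∧ f ≠ 0 ∧
          J = (∫ x, ‖f x‖ ^ (p + 1)) /
              ((∫ x, ‖f x‖ ^ 2) ^ (((d : ℝ) + 2 - ((d : ℝ) - 2) * p) / 4) *
               (∫ x, (gradNormSq d f x + a * ‖f x‖ ^ 2 / ‖x‖ ^ 2)) ^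
                 ((d : ℝ) * (p - 1) / 4)) } with hT
  have hbdd : BddAbove T := by
    refine ⟨B, ?_⟩
    rintro J ⟨f, hf, hc, h0, -, hne, rfl⟩
    obtain ⟨h1, h2, h3⟩ := hpos f hf hc h0 hne
    rw [div_le_iff₀ (by positivity)]
    exact (hB f hf hc h0).2
  obtain ⟨f₀, hf₀, hc₀, h0₀, hr₀, hne₀⟩ := gn_exists_radial d hd
  have hmem : ∀ f : EuclideanSpace ℝ (Fin d) → ℂ,
      ContDiff ℝ (⊤ : ℕ∞) f → HasCompactSupport f →
      (0 : EuclideanSpace ℝ (Fin d)) ∉ tsupport f →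
      (∀ x y, ‖x‖ = ‖y‖ → f x = f y) → f ≠ 0 →
      (∫ x, ‖f x‖ ^ (p + 1)) /
              ((∫ x, ‖f x‖ ^ 2) ^ (((d : ℝ) + 2 - ((d : ℝ) - 2) * p) / 4) *
               (∫ x, (gradNormSq d f x + a * ‖f x‖ ^ 2 / ‖x‖ ^ 2)) ^
                 ((d : ℝ) * (p - 1) / 4)) ∈ T :=
    fun f hf hc h0 hr hne => ⟨f, hf, hc, h0, hr, hne, rfl⟩
  have hlub : IsLUB T (sSup T) := isLUB_csSup ⟨_, hmem f₀ hf₀ hc₀ h0₀ hr₀ hne₀⟩ hbdd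
  have hCpos : 0 < sSup T := by
    refine lt_of_lt_of_le ?_ (hlub.1 (hmem f₀ hf₀ hc₀ h0₀ hr₀ hne₀))
    obtain ⟨h1, h2, h3⟩ := hpos f₀ hf₀ hc₀ h0₀ hne₀
    positivity
  refine ⟨sSup T, hCpos, hlub, fun f hf hc h0 hr => ?_⟩
  by_cases hne : f = 0
  · have h1 : ∫ x, ‖f x‖ ^ (p + 1) = 0 := by
      simp [hne, Real.zero_rpow (show p + 1 ≠ 0 by linarith)]
    rw [h1]
    have h2 := (hB f hf hc h0).1
    have h3 : 0 ≤ ∫ x, ‖f x‖ ^ 2 := integral_nonneg fun x => by positivity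
    positivity
  · obtain ⟨h1, h2, h3⟩ := hpos f hf hc h0 hne
    have h4 := hlub.1 (hmem f hf hc h0 hr hne)
    rw [div_le_iff₀ (by positivity)] at h4
    rw [mul_assoc]
    exact h4
end

section
/- Let d ≥ 3, a > -((d-2)/2)², and p > 1 with dp ≠ d + 4 permitted (no restriction needed). Suppose Q : (0,∞) → ℝ is of class C² and satisfies Q''(r) + ((d-1)/r) Q'(r) - (a/r²) Q(r) - Q(r) + |Q(r)|^{p-1} Q(r) = 0 for all r > 0, and there exist constants C, δ, ε > 0 such that |Q(r)| + |Q'(r)| ≤ C e^{-δ r} for all r ≥ 1, and |Q(r)| ≤ C r^{1 - d/2 + ε} and |Q'(r)| ≤ C r^{-d/2 + ε} for all 0 < r ≤ 1. Define the energy E := ∫₀^∞ [ (1/2)(Q'(r)² + a Q(r)²/r²) - (1/(p+1))|Q(r)|^{p+1} ] r^{d-1} dr. Then E = ((dp-(d+4))/(2d(p-1))) ∫₀^∞ (Q'(r)² + a Q(r)²/r²) r^{d-1} dr = ((dp-(d+4))/(4(p+1))) ∫₀^∞ |Q(r)|^{p+1} r^{d-1} dr. -/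
open MeasureTheory Set

open Filter Topology in
theorem aux_tail {f : ℝ → ℝ} (hf : IntegrableOn f (Ioi 0)) :
    Tendsto (fun x => ∫ r in Ioi x, f r) (𝓝[>] (0:ℝ)) (𝓝 (∫ r in Ioi (0:ℝ), f r)) := by
  have hc : AECover (volume.restrict (Ioi (0:ℝ))) (𝓝[>] (0:ℝ)) (fun x => Ioi x) :=
    aecover_Ioi_of_Ioi (tendsto_id.mono_left nhdsWithin_le_nhds)
  refine (hc.integral_tendsto_of_countably_generated hf).congr' ?_
  filter_upwards [self_mem_nhdsWithin] with x hx
  rw [Measure.restrict_restrict measurableSet_Ioi,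
    inter_eq_left.2 (Ioi_subset_Ioi (le_of_lt hx))]

open Filter Topology in
theorem aux_ftc {F f : ℝ → ℝ} (hd : ∀ x, 0 < x → HasDerivAt F (f x) x)
    (hf : IntegrableOn f (Ioi 0)) (hF : Tendsto F atTop (𝓝 0)) :
    Tendsto F (𝓝[>] (0:ℝ)) (𝓝 (-∫ r in Ioi (0:ℝ), f r)) := by
  refine (aux_tail hf).neg.congr' ?_
  filter_upwards [self_mem_nhdsWithin] with x hx
  have hx : 0 < x := hx
  rw [integral_Ioi_of_hasDerivAt_of_tendsto' (f := F) (fun y hy => hd y (lt_of_lt_of_le hx hy))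
    (hf.mono_set (Ioi_subset_Ioi hx.le)) hF]
  ring

theorem aux_int_inf {f : ℝ → ℝ} (hc : ContinuousOn f (Ioi 0)) (A s b : ℝ) (hs : 0 ≤ s) (hb : 0 < b)
    (h : ∀ r, 1 ≤ r → |f r| ≤ A * (r ^ s * Real.exp (-b * r))) {x : ℝ} (hx : 0 < x) :
    IntegrableOn f (Ioi x) := by
  have h1 : IntegrableOn f (Ioi 1) := by
    have hg : IntegrableOn (fun r : ℝ => A * (r ^ s * Real.exp (-b * r))) (Ioi 1) := by
      have := integrableOn_rpow_mul_exp_neg_mul_rpow (p := 1) (s := s) (b := b)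
        (by linarith) one_pos hb
      simp only [Real.rpow_one] at this
      exact (this.mono_set (Ioi_subset_Ioi zero_le_one)).const_mul A
    refine Integrable.mono' hg ((hc.mono (Ioi_subset_Ioi zero_le_one)).aestronglyMeasurable
      measurableSet_Ioi) ?_
    filter_upwards [ae_restrict_mem measurableSet_Ioi] with r hr
    exact h r (le_of_lt hr)
  have h2 : IntegrableOn f (Icc x (max x 1)) :=
    (hc.mono fun y hy => lt_of_lt_of_le hx hy.1).integrableOn_Icc
  refine (h1.union h2).mono_set fun y hy => ?_
  by_cases hy1 : 1 < y
  · exact Or.inl hy1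
  · exact Or.inr ⟨le_of_lt hy, le_max_of_le_right (not_lt.1 hy1)⟩

theorem aux_int {f : ℝ → ℝ} (hc : ContinuousOn f (Ioi 0)) (A s b B η : ℝ) (hs : 0 ≤ s) (hb : 0 < b)
    (hη : 0 < η)
    (h : ∀ r, 1 ≤ r → |f r| ≤ A * (r ^ s * Real.exp (-b * r)))
    (h0 : ∀ r, 0 < r → r ≤ 1 → |f r| ≤ B * r ^ (η - 1)) :
    IntegrableOn f (Ioi 0) := by
  have h1 := aux_int_inf hc A s b hs hb h one_pos
  have h2 : IntegrableOn f (Ioc 0 1) := by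
    have hg : IntegrableOn (fun r : ℝ => B * r ^ (η - 1)) (Ioc 0 1) := by
      have := intervalIntegral.intervalIntegrable_rpow' (a := 0) (b := 1) (r := η - 1)
        (by linarith)
      rw [intervalIntegrable_iff_integrableOn_Ioc_of_le zero_le_one] at this
      exact this.const_mul B
    refine Integrable.mono' hg ((hc.mono Ioc_subset_Ioi_self).aestronglyMeasurable
      measurableSet_Ioc) ?_
    filter_upwards [ae_restrict_mem measurableSet_Ioc] with r hr
    exact h0 r hr.1 hr.2
  rw [← Ioc_union_Ioi_eq_Ioi (zero_le_one : (0:ℝ) ≤ 1)]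
  exact h2.union h1

open Filter Topology in
theorem aux_lim_inf {f : ℝ → ℝ} (A s b : ℝ) (hb : 0 < b)
    (h : ∀ r, 1 ≤ r → |f r| ≤ A * (r ^ s * Real.exp (-b * r))) :
    Tendsto f atTop (𝓝 0) := by
  refine squeeze_zero_norm' (a := fun r => A * (r ^ s * Real.exp (-b * r))) ?_ ?_
  · filter_upwards [eventually_ge_atTop 1] with r hr using h r hr
  · simpa using (tendsto_rpow_mul_exp_neg_mul_atTop_nhds_zero s b hb).const_mul A

open Filter Topology in
theorem aux_lim_zero {f : ℝ → ℝ} (B η : ℝ) (hη : 0 < η)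
    (h : ∀ r, 0 < r → r ≤ 1 → |f r| ≤ B * r ^ η) :
    Tendsto f (𝓝[>] 0) (𝓝 0) := by
  refine squeeze_zero_norm' (a := fun r => B * r ^ η) ?_ ?_
  · filter_upwards [Ioc_mem_nhdsGT (zero_lt_one : (0:ℝ) < 1)] with r hr using h r hr.1 hr.2
  · have : ContinuousAt (fun r : ℝ => B * r ^ η) 0 :=
      (Real.continuousAt_rpow_const 0 η (Or.inr hη.le)).const_mul B
    have h2 := this.tendsto
    simp only [Real.zero_rpow hη.ne', mul_zero] at h2
    exact h2.mono_left nhdsWithin_le_nhds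

open Filter Topology in
theorem aux_no_mass {f : ℝ → ℝ} (hf : IntegrableOn f (Ioi 0)) {L : ℝ} (h0 : ∀ r, 0 < r → 0 ≤ f r)
    (h : Tendsto (fun r => r * f r) (𝓝[>] 0) (𝓝 L)) : L = 0 := by
  have hL : 0 ≤ L := by
    refine ge_of_tendsto h ?_
    filter_upwards [self_mem_nhdsWithin] with r hr
    exact mul_nonneg (le_of_lt hr) (h0 r hr)
  by_contra hne
  have hL : 0 < L := lt_of_le_of_ne hL (Ne.symm hne)
  have he : ∀ᶠ r in 𝓝[>] (0:ℝ), L / 2 < r * f r := h.eventually_const_lt (by linarith)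
  obtain ⟨u, hu, hsub⟩ := mem_nhdsGT_iff_exists_Ioc_subset.1 he
  have hu : 0 < u := hu
  have hi : IntervalIntegrable (fun x : ℝ => x⁻¹) volume 0 u := by
    rw [intervalIntegrable_iff_integrableOn_Ioc_of_le hu.le]
    have hg : IntegrableOn (fun r => (2 / L) * f r) (Ioc 0 u) :=
      (hf.mono_set Ioc_subset_Ioi_self).const_mul _
    refine Integrable.mono' hg measurable_inv.aestronglyMeasurable ?_
    filter_upwards [ae_restrict_mem measurableSet_Ioc] with r hr
    have h1 : L / 2 < r * f r := hsub hr
    have hr0 : 0 < r := hr.1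
    rw [Real.norm_of_nonneg (inv_nonneg.2 hr0.le), inv_le_iff_one_le_mul₀ hr0]
    have : 1 = (2 / L) * (L / 2) := by field_simp
    calc 1 = (2 / L) * (L / 2) := this
      _ ≤ (2 / L) * (r * f r) := by gcongr
      _ = _ := by ring
  rw [intervalIntegrable_inv_iff] at hi
  rcases hi with hi | hi
  · exact hu.ne hi
  · exact hi left_mem_uIcc

/-- Energy identities (Lemma 3.3, identity (3.4)) for a decaying solution `Q` of the
radial elliptic equation `Q'' + ((d-1)/r) Q' - (a/r²) Q - Q + |Q|^{p-1} Q = 0` on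
`(0,∞)`: the energy `E` satisfies
`E = ((dp-(d+4))/(2d(p-1))) ∫ (Q'² + aQ²/r²) r^{d-1} dr
   = ((dp-(d+4))/(4(p+1))) ∫ |Q|^{p+1} r^{d-1} dr`. -/
theorem ground_state_energy_identities (d : ℕ) (hd : 3 ≤ d) (a p : ℝ)
    (ha : -((((d : ℝ) - 2) / 2) ^ 2) < a) (hp : 1 < p)
    (Q : ℝ → ℝ) (hQ : ContDiffOn ℝ 2 Q (Ioi 0))
    (heq : ∀ r : ℝ, 0 < r →
      deriv (deriv Q) r + (((d : ℝ) - 1) / r) * deriv Q r - (a / r ^ 2) * Q r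
        - Q r + |Q r| ^ (p - 1) * Q r = 0)
    (C δ ε : ℝ) (hC : 0 < C) (hδ : 0 < δ) (hε : 0 < ε)
    (hdecay : ∀ r : ℝ, 1 ≤ r → |Q r| + |deriv Q r| ≤ C * Real.exp (-δ * r))
    (hzero₁ : ∀ r : ℝ, 0 < r → r ≤ 1 → |Q r| ≤ C * r ^ (1 - (d : ℝ) / 2 + ε))
    (hzero₂ : ∀ r : ℝ, 0 < r → r ≤ 1 → |deriv Q r| ≤ C * r ^ (-(d : ℝ) / 2 + ε)) :
    (∫ r in Ioi (0 : ℝ),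
        ((1 / 2) * (deriv Q r ^ 2 + a * Q r ^ 2 / r ^ 2)
          - (1 / (p + 1)) * |Q r| ^ (p + 1)) * r ^ ((d : ℝ) - 1)) =
        (((d : ℝ) * p - ((d : ℝ) + 4)) / (2 * (d : ℝ) * (p - 1))) *
          ∫ r in Ioi (0 : ℝ), (deriv Q r ^ 2 + a * Q r ^ 2 / r ^ 2) * r ^ ((d : ℝ) - 1) ∧
      (∫ r in Ioi (0 : ℝ),
        ((1 / 2) * (deriv Q r ^ 2 + a * Q r ^ 2 / r ^ 2)
          - (1 / (p + 1)) * |Q r| ^ (p + 1)) * r ^ ((d : ℝ) - 1)) =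
        (((d : ℝ) * p - ((d : ℝ) + 4)) / (4 * (p + 1))) *
          ∫ r in Ioi (0 : ℝ), |Q r| ^ (p + 1) * r ^ ((d : ℝ) - 1) := by
  have hdpos : (3:ℝ) ≤ d := by exact_mod_cast hd
  obtain ⟨w, hw⟩ : ∃ w : ℝ → ℝ, w = fun r => r ^ ((d:ℝ) - 1) := ⟨_, rfl⟩
  have hw' : ∀ r : ℝ, r ^ ((d:ℝ) - 1) = w r := fun r => by rw [hw]
  simp only [hw']
  have hwpos : ∀ r, 0 < r → 0 < w r := fun r hr => by rw [hw]; exact Real.rpow_pos_of_pos hr _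
  have hwd : ∀ r, 0 < r → HasDerivAt w (((d:ℝ) - 1) / r * w r) r := by
    intro r hr
    rw [hw]
    convert! Real.hasDerivAt_rpow_const (p := (d:ℝ) - 1) (Or.inl hr.ne') using 1
    rw [Real.rpow_sub_one hr.ne']
    ring
  have hnh : ∀ r : ℝ, 0 < r → Ioi (0:ℝ) ∈ nhds r := fun r hr => Ioi_mem_nhds hr
  have hQd : ∀ r, 0 < r → HasDerivAt Q (deriv Q r) r := fun r hr =>
    ((hQ.contDiffAt (hnh r hr)).differentiableAt (by norm_num)).hasDerivAt
  have hQ1 : ContDiffOn ℝ 1 (deriv Q) (Ioi 0) :=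
    ((contDiffOn_succ_iff_deriv_of_isOpen (n := 1) isOpen_Ioi).1
      (by simpa [one_add_one_eq_two] using hQ)).2.2
  have hQdd : ∀ r, 0 < r → HasDerivAt (deriv Q) (deriv (deriv Q) r) r := fun r hr =>
    ((hQ1.contDiffAt (hnh r hr)).differentiableAt (by norm_num)).hasDerivAt
  have cQ : ContinuousOn Q (Ioi 0) := hQ.continuousOn
  have cQ' : ContinuousOn (deriv Q) (Ioi 0) := hQ1.continuousOn
  have cw : ContinuousOn w (Ioi 0) := fun r hr =>
    (hwd r hr).continuousAt.continuousWithinAt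
  -- pointwise bounds near zero
  have b1 : ∀ r, 0 < r → r ≤ 1 → Q r ^ 2 / r ^ 2 * (r * w r) ≤ C ^ 2 * r ^ (2 * ε) := by
    intro r hr hr1
    have h := hzero₁ r hr hr1
    have h2 : Q r ^ 2 ≤ (C * r ^ (1 - (d:ℝ) / 2 + ε)) ^ 2 := sq_le_sq.2 (h.trans (le_abs_self _))
    calc Q r ^ 2 / r ^ 2 * (r * w r)
        ≤ (C * r ^ (1 - (d:ℝ) / 2 + ε)) ^ 2 / r ^ 2 * (r * w r) := by
          have := hwpos r hr
          gcongr
      _ = C ^ 2 * r ^ (2 * ε) := by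
          obtain ⟨s, hs⟩ : ∃ s : ℝ, s = 1 - (d:ℝ) / 2 + ε := ⟨_, rfl⟩
          rw [← hs, show (2 * ε : ℝ) = s + s + ((d:ℝ) - 1) - 1 by rw [hs]; ring,
            Real.rpow_sub_one hr.ne', Real.rpow_add hr, Real.rpow_add hr, hw' r]
          generalize r ^ s = X
          field_simp
  have b2 : ∀ r, 0 < r → r ≤ 1 → deriv Q r ^ 2 * (r * w r) ≤ C ^ 2 * r ^ (2 * ε) := by
    intro r hr hr1
    have h := hzero₂ r hr hr1
    have h2 : deriv Q r ^ 2 ≤ (C * r ^ (-(d:ℝ) / 2 + ε)) ^ 2 := sq_le_sq.2 (h.trans (le_abs_self _))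
    calc deriv Q r ^ 2 * (r * w r)
        ≤ (C * r ^ (-(d:ℝ) / 2 + ε)) ^ 2 * (r * w r) := by
          have := hwpos r hr
          gcongr
      _ = C ^ 2 * r ^ (2 * ε) := by
          obtain ⟨s, hs⟩ : ∃ s : ℝ, s = -(d:ℝ) / 2 + ε := ⟨_, rfl⟩
          rw [← hs, show (2 * ε : ℝ) = s + s + ((d:ℝ) - 1) + 1 by rw [hs]; ring,
            Real.rpow_add_one hr.ne', Real.rpow_add hr, Real.rpow_add hr, hw' r]
          ring
  have b3 : ∀ r, 0 < r → r ≤ 1 → Q r ^ 2 * (r * w r) ≤ C ^ 2 * r ^ (2 * ε) := by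
    intro r hr hr1
    refine le_trans ?_ (b1 r hr hr1)
    have := hwpos r hr
    gcongr
    rw [le_div_iff₀ (by positivity)]
    exact mul_le_of_le_one_right (sq_nonneg _) (pow_le_one₀ hr.le hr1)
  -- pointwise bounds near infinity
  have e1 : ∀ r, 1 ≤ r → Q r ^ 2 * (r * w r) ≤ C ^ 2 * (r ^ (d:ℝ) * Real.exp (-(2 * δ) * r)) ∧
      deriv Q r ^ 2 * (r * w r) ≤ C ^ 2 * (r ^ (d:ℝ) * Real.exp (-(2 * δ) * r)) ∧
      |Q r| ^ (p + 1) * (r * w r)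
        ≤ C ^ (p + 1) * (r ^ (d:ℝ) * Real.exp (-((p + 1) * δ) * r)) := by
    intro r hr
    have hr0 : 0 < r := by linarith
    have h := hdecay r hr
    have hq : |Q r| ≤ C * Real.exp (-δ * r) := by linarith [abs_nonneg (deriv Q r)]
    have hq' : |deriv Q r| ≤ C * Real.exp (-δ * r) := by linarith [abs_nonneg (Q r)]
    have hrw : r * w r = r ^ (d:ℝ) := by
      rw [hw]; simp only []; rw [Real.rpow_sub_one hr0.ne']; field_simp
    have hpos : 0 < r ^ (d:ℝ) := Real.rpow_pos_of_pos hr0 _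
    have hee : (C * Real.exp (-δ * r)) ^ 2 = C ^ 2 * Real.exp (-(2 * δ) * r) := by
      rw [mul_pow, ← Real.exp_nat_mul]; congr 2; push_cast; ring
    have hee2 : (C * Real.exp (-δ * r)) ^ (p + 1)
        = C ^ (p + 1) * Real.exp (-((p + 1) * δ) * r) := by
      rw [Real.mul_rpow hC.le (Real.exp_pos _).le, ← Real.exp_mul]; congr 2; ring
    rw [hrw]
    refine ⟨?_, ?_, ?_⟩
    · calc Q r ^ 2 * r ^ (d:ℝ) ≤ (C * Real.exp (-δ * r)) ^ 2 * r ^ (d:ℝ) := by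
            gcongr ?_ * _
            exact sq_le_sq.2 (hq.trans (le_abs_self _))
        _ = _ := by rw [hee]; ring
    · calc deriv Q r ^ 2 * r ^ (d:ℝ) ≤ (C * Real.exp (-δ * r)) ^ 2 * r ^ (d:ℝ) := by
            gcongr ?_ * _
            exact sq_le_sq.2 (hq'.trans (le_abs_self _))
        _ = _ := by rw [hee]; ring
    · calc |Q r| ^ (p + 1) * r ^ (d:ℝ) ≤ (C * Real.exp (-δ * r)) ^ (p + 1) * r ^ (d:ℝ) := by
            gcongr ?_ * _
            exact Real.rpow_le_rpow (abs_nonneg _) hq (by linarith)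
        _ = _ := by rw [hee2]; ring
  have e2 : ∀ r, 1 ≤ r →
      Q r ^ 2 / r ^ 2 * (r * w r) ≤ C ^ 2 * (r ^ (d:ℝ) * Real.exp (-(2 * δ) * r)) := by
    intro r hr
    refine le_trans ?_ (e1 r hr).1
    have := hwpos r (by linarith)
    gcongr
    exact div_le_self (sq_nonneg _) (one_le_pow₀ hr)
  have wle : ∀ r, 1 ≤ r → ∀ x, 0 ≤ x → x * w r ≤ x * (r * w r) := by
    intro r hr x hx
    have := hwpos r (by linarith)
    gcongr
    exact le_mul_of_one_le_left this.le hr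
  have wle0 : ∀ r, 0 < r → ∀ x B : ℝ, x * (r * w r) ≤ B * r ^ (2 * ε) →
      x * w r ≤ B * r ^ (2 * ε - 1) := by
    intro r hr x B h
    rw [Real.rpow_sub_one hr.ne', ← mul_div_assoc, le_div_iff₀ hr]
    linarith
  -- integrability
  have iQ' : IntegrableOn (fun r => deriv Q r ^ 2 * w r) (Ioi 0) := by
    refine aux_int ((cQ'.pow 2).mul cw) (C ^ 2) d (2 * δ) (C ^ 2) (2 * ε) (by linarith)
      (by linarith) (by linarith) ?_ ?_
    · intro r hr
      have := hwpos r (by linarith)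
      rw [abs_of_nonneg (by positivity)]
      exact (wle r hr _ (sq_nonneg _)).trans (e1 r hr).2.1
    · intro r hr hr1
      have := hwpos r hr
      rw [abs_of_nonneg (by positivity)]
      exact wle0 r hr _ _ (b2 r hr hr1)
  have iQ : IntegrableOn (fun r => Q r ^ 2 * w r) (Ioi 0) := by
    refine aux_int ((cQ.pow 2).mul cw) (C ^ 2) d (2 * δ) (C ^ 2) (2 * ε) (by linarith)
      (by linarith) (by linarith) ?_ ?_
    · intro r hr
      have := hwpos r (by linarith)
      rw [abs_of_nonneg (by positivity)]
      exact (wle r hr _ (sq_nonneg _)).trans (e1 r hr).1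
    · intro r hr hr1
      have := hwpos r hr
      rw [abs_of_nonneg (by positivity)]
      exact wle0 r hr _ _ (b3 r hr hr1)
  have iV : IntegrableOn (fun r => Q r ^ 2 / r ^ 2 * w r) (Ioi 0) := by
    refine aux_int (((cQ.pow 2).div (continuousOn_id.pow 2)
      (fun x hx => pow_ne_zero 2 (ne_of_gt hx))).mul cw) (C ^ 2) d (2 * δ) (C ^ 2) (2 * ε)
      (by linarith) (by linarith) (by linarith) ?_ ?_
    · intro r hr
      have := hwpos r (by linarith)
      rw [abs_of_nonneg (by positivity)]
      exact (wle r hr _ (by positivity)).trans (e2 r hr)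
    · intro r hr hr1
      have := hwpos r hr
      rw [abs_of_nonneg (by positivity)]
      exact wle0 r hr _ _ (b1 r hr hr1)
  have iK : IntegrableOn (fun r => (deriv Q r ^ 2 + a * Q r ^ 2 / r ^ 2) * w r) (Ioi 0) := by
    refine (iQ'.add (iV.const_mul a)).congr (ae_of_all _ fun r => ?_)
    simp only [Pi.add_apply]; ring
  have cN : ContinuousOn (fun r => |Q r| ^ (p + 1) * w r) (Ioi 0) :=
    (cQ.abs.rpow_const (fun _ _ => Or.inr (by linarith))).mul cw
  have iN1 : ∀ x : ℝ, 0 < x → IntegrableOn (fun r => |Q r| ^ (p + 1) * w r) (Ioi x) := by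
    intro x hx
    refine aux_int_inf cN (C ^ (p + 1)) d ((p + 1) * δ) (by linarith) (by positivity) ?_ hx
    intro r hr
    have := hwpos r (by linarith)
    rw [abs_of_nonneg (by positivity)]
    exact (wle r hr _ (by positivity)).trans (e1 r hr).2.2
  -- first identity
  have hNp : ∀ r, |Q r| ^ (p + 1) = |Q r| ^ (p - 1) * Q r ^ 2 := by
    intro r
    rw [← sq_abs (Q r), ← Real.rpow_two, ← Real.rpow_add_of_nonneg (abs_nonneg _) (by linarith)
      (by norm_num)]
    congr 1; ring
  have hF1 : ∀ r, 0 < r → HasDerivAt (fun r => w r * (Q r * deriv Q r))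
      ((deriv Q r ^ 2 + a * Q r ^ 2 / r ^ 2) * w r + Q r ^ 2 * w r - |Q r| ^ (p + 1) * w r) r := by
    intro r hr
    convert! (hwd r hr).mul ((hQd r hr).mul (hQdd r hr)) using 1
    rw [hNp]
    simp only [Pi.mul_apply]
    linear_combination (-(w r) * Q r) * heq r hr
  have habs : ∀ x y : ℝ, |x * y| ≤ x ^ 2 + y ^ 2 := by
    intro x y
    rw [abs_le]; constructor <;> nlinarith [sq_nonneg (x + y), sq_nonneg (x - y)]
  have hF1top : Filter.Tendsto (fun r => w r * (Q r * deriv Q r)) Filter.atTop (nhds 0) := by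
    refine aux_lim_inf (2 * C ^ 2) d (2 * δ) (by linarith) ?_
    intro r hr
    have hwp := hwpos r (by linarith)
    rw [abs_mul, abs_of_pos hwp]
    have h1 := (wle r hr _ (sq_nonneg _)).trans (e1 r hr).1
    have h2 := (wle r hr _ (sq_nonneg _)).trans (e1 r hr).2.1
    nlinarith [mul_le_mul_of_nonneg_left (habs (Q r) (deriv Q r)) hwp.le]
  have hF1zero : Filter.Tendsto (fun r => w r * (Q r * deriv Q r)) (nhdsWithin 0 (Ioi 0))
      (nhds 0) := by
    refine aux_lim_zero (2 * C ^ 2) (2 * ε) (by linarith) ?_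
    intro r hr hr1
    have hwp := hwpos r hr
    have h1 := b1 r hr hr1
    have h2 := b2 r hr hr1
    have h3 := mul_le_mul_of_nonneg_left (habs (Q r / r) (deriv Q r)) (mul_pos hr hwp).le
    have h4 : |w r * (Q r * deriv Q r)| = r * w r * |Q r / r * deriv Q r| := by
      rw [← abs_of_pos (mul_pos hr hwp), ← abs_mul]
      congr 1; field_simp
    rw [h4]
    rw [div_pow] at h3
    linarith
  have iKM : IntegrableOn (fun r => (deriv Q r ^ 2 + a * Q r ^ 2 / r ^ 2) * w r + Q r ^ 2 * w r)
    (Ioi 0) := iK.add iQ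
  have iN : IntegrableOn (fun r => |Q r| ^ (p + 1) * w r) (Ioi 0) := by
    have hlim : Filter.Tendsto (fun n : ℕ => 1 / ((n:ℝ) + 1)) Filter.atTop (nhds 0) :=
      tendsto_one_div_add_atTop_nhds_zero_nat
    have hpos : ∀ n : ℕ, 0 < 1 / ((n:ℝ) + 1) := fun n => by positivity
    have hlim' : Filter.Tendsto (fun n : ℕ => 1 / ((n:ℝ) + 1)) Filter.atTop
        (nhdsWithin 0 (Ioi 0)) :=
      tendsto_nhdsWithin_iff.2 ⟨hlim, Filter.Eventually.of_forall hpos⟩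
    have hc := aecover_Ioi_of_Ioi (μ := volume) hlim
    have hres : ∀ n : ℕ, (volume.restrict (Ioi (0:ℝ))).restrict (Ioi (1 / ((n:ℝ) + 1)))
        = volume.restrict (Ioi (1 / ((n:ℝ) + 1))) := fun n => by
      rw [Measure.restrict_restrict measurableSet_Ioi,
        inter_eq_left.2 (Ioi_subset_Ioi (hpos n).le)]
    refine hc.integrable_of_integral_tendsto_of_nonneg_ae
      ((∫ r in Ioi (0:ℝ), ((deriv Q r ^ 2 + a * Q r ^ 2 / r ^ 2) * w r + Q r ^ 2 * w r)) + 0)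
      (fun n => ?_) ?_ ?_
    · rw [IntegrableOn, hres]; exact iN1 _ (hpos n)
    · filter_upwards [ae_restrict_mem measurableSet_Ioi] with r hr
      have := hwpos r hr
      positivity
    · refine (((aux_tail iKM).add hF1zero).comp hlim').congr fun n => ?_
      rw [hres]
      have hx := hpos n
      set x := 1 / ((n:ℝ) + 1)
      have iKMx := iKM.mono_set (Ioi_subset_Ioi hx.le)
      have := integral_Ioi_of_hasDerivAt_of_tendsto' (a := x)
        (fun y hy => hF1 y (lt_of_lt_of_le hx hy)) (iKMx.sub (iN1 x hx)) hF1top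
      rw [integral_sub iKMx (iN1 x hx)] at this
      simp only [Function.comp, Pi.add_apply] at this ⊢
      linarith
  have I1 := tendsto_nhds_unique (aux_ftc hF1 (iKM.sub iN) hF1top) hF1zero
  rw [integral_sub iKM iN, integral_add iK iQ] at I1
  -- Pohozaev identity
  have hF2 : ∀ r, 0 < r → HasDerivAt (fun r => (r * w r) * ((1 / 2) * deriv Q r ^ 2
        - (a / 2) * (Q r ^ 2 / r ^ 2) - (1 / 2) * Q r ^ 2 + (1 / (p + 1)) * |Q r| ^ (p + 1)))
      ((-((d:ℝ) - 2) / 2) * ((deriv Q r ^ 2 + a * Q r ^ 2 / r ^ 2) * w r)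
        + (-(d:ℝ) / 2) * (Q r ^ 2 * w r) + ((d:ℝ) / (p + 1)) * (|Q r| ^ (p + 1) * w r)) r := by
    intro r hr
    have hN := (hasDerivAt_abs_rpow (Q r) (p := p + 1) (by linarith)).comp r (hQd r hr)
    have hD := ((hasDerivAt_id r).mul (hwd r hr)).mul
      ((((((hQdd r hr).pow 2).const_mul (1 / 2)).sub
        ((((hQd r hr).pow 2).div ((hasDerivAt_id r).pow 2) (pow_ne_zero 2 hr.ne')).const_mul
          (a / 2))).sub (((hQd r hr).pow 2).const_mul (1 / 2))).add (hN.const_mul (1 / (p + 1))))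
    convert! hD using 1
    have hE := heq r hr
    have hE' : deriv (deriv Q) r = -((((d:ℝ) - 1) / r) * deriv Q r) + (a / r ^ 2) * Q r
        + Q r - |Q r| ^ (p - 1) * Q r := by linarith
    have hp1 : p + 1 ≠ 0 := by linarith
    simp only [Pi.mul_apply, Pi.pow_apply, Pi.add_apply, Pi.sub_apply, Pi.div_apply, id,
      Function.comp, hE', hNp, show p + 1 - 2 = p - 1 by ring]
    generalize |Q r| ^ (p - 1) = N
    field_simp
    push_cast
    ring
  have hF2top : Filter.Tendsto (fun r => (r * w r) * ((1 / 2) * deriv Q r ^ 2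
        - (a / 2) * (Q r ^ 2 / r ^ 2) - (1 / 2) * Q r ^ 2 + (1 / (p + 1)) * |Q r| ^ (p + 1)))
      Filter.atTop (nhds 0) := by
    have t1 : Filter.Tendsto (fun r => deriv Q r ^ 2 * (r * w r)) Filter.atTop (nhds 0) := by
      refine aux_lim_inf (C ^ 2) d (2 * δ) (by linarith) fun r hr => ?_
      have hr0 : 0 < r := by linarith
      have := hwpos r hr0
      rw [abs_of_nonneg (by positivity)]; exact (e1 r hr).2.1
    have t2 : Filter.Tendsto (fun r => Q r ^ 2 * (r * w r)) Filter.atTop (nhds 0) := by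
      refine aux_lim_inf (C ^ 2) d (2 * δ) (by linarith) fun r hr => ?_
      have hr0 : 0 < r := by linarith
      have := hwpos r hr0
      rw [abs_of_nonneg (by positivity)]; exact (e1 r hr).1
    have t3 : Filter.Tendsto (fun r => Q r ^ 2 / r ^ 2 * (r * w r)) Filter.atTop (nhds 0) := by
      refine aux_lim_inf (C ^ 2) d (2 * δ) (by linarith) fun r hr => ?_
      have hr0 : 0 < r := by linarith
      have := hwpos r hr0
      rw [abs_of_nonneg (by positivity)]; exact e2 r hr
    have t4 : Filter.Tendsto (fun r => |Q r| ^ (p + 1) * (r * w r)) Filter.atTop (nhds 0) := by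
      refine aux_lim_inf (C ^ (p + 1)) d ((p + 1) * δ) (by positivity) fun r hr => ?_
      have hr0 : 0 < r := by linarith
      have := hwpos r hr0
      rw [abs_of_nonneg (by positivity)]; exact (e1 r hr).2.2
    have := (((t1.const_mul (1 / 2)).sub (t3.const_mul (a / 2))).sub (t2.const_mul (1 / 2))).add
      (t4.const_mul (1 / (p + 1)))
    simp only [mul_zero, sub_zero, add_zero] at this
    refine this.congr fun r => ?_
    ring
  have iG0 : IntegrableOn (fun r =>
      (-((d:ℝ) - 2) / 2) * ((deriv Q r ^ 2 + a * Q r ^ 2 / r ^ 2) * w r)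
        + (-(d:ℝ) / 2) * (Q r ^ 2 * w r)) (Ioi 0) :=
    (iK.const_mul (-((d:ℝ) - 2) / 2)).add (iQ.const_mul (-(d:ℝ) / 2))
  have iG := ((iK.const_mul (-((d:ℝ) - 2) / 2)).add (iQ.const_mul (-(d:ℝ) / 2))).add
    (iN.const_mul ((d:ℝ) / (p + 1)))
  have L2 := aux_ftc hF2 iG hF2top
  have z1 : Filter.Tendsto (fun r => deriv Q r ^ 2 * (r * w r)) (nhdsWithin 0 (Ioi 0))
      (nhds 0) := by
    refine aux_lim_zero (C ^ 2) (2 * ε) (by linarith) fun r hr hr1 => ?_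
    have := hwpos r hr
    rw [abs_of_nonneg (by positivity)]; exact b2 r hr hr1
  have z2 : Filter.Tendsto (fun r => Q r ^ 2 * (r * w r)) (nhdsWithin 0 (Ioi 0)) (nhds 0) := by
    refine aux_lim_zero (C ^ 2) (2 * ε) (by linarith) fun r hr hr1 => ?_
    have := hwpos r hr
    rw [abs_of_nonneg (by positivity)]; exact b3 r hr hr1
  have z3 : Filter.Tendsto (fun r => Q r ^ 2 / r ^ 2 * (r * w r)) (nhdsWithin 0 (Ioi 0))
      (nhds 0) := by
    refine aux_lim_zero (C ^ 2) (2 * ε) (by linarith) fun r hr hr1 => ?_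
    have := hwpos r hr
    rw [abs_of_nonneg (by positivity)]; exact b1 r hr hr1
  have hp1 : p + 1 ≠ 0 := by linarith
  have z4 := ((((L2.sub (z1.const_mul (1 / 2))).add (z3.const_mul (a / 2))).add
    (z2.const_mul (1 / 2))).const_mul (p + 1)).congr
    (f₂ := fun r => r * (|Q r| ^ (p + 1) * w r)) (fun r => by
      generalize Q r ^ 2 / r ^ 2 = V
      field_simp
      ring)
  have I2 := aux_no_mass iN (fun r hr => by have := hwpos r hr; positivity) z4
  simp only [mul_zero, sub_zero, add_zero] at I2
  have I2 := (mul_eq_zero.1 I2).resolve_left hp1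
  rw [integral_add iG0 (iN.const_mul _),
    integral_add (iK.const_mul _) (iQ.const_mul _), integral_const_mul, integral_const_mul,
    integral_const_mul] at I2
  have IE : (∫ r in Ioi (0 : ℝ), ((1 / 2) * (deriv Q r ^ 2 + a * Q r ^ 2 / r ^ 2)
      - (1 / (p + 1)) * |Q r| ^ (p + 1)) * w r)
      = (1 / 2) * (∫ r in Ioi (0 : ℝ), (deriv Q r ^ 2 + a * Q r ^ 2 / r ^ 2) * w r)
        - (1 / (p + 1)) * ∫ r in Ioi (0 : ℝ), |Q r| ^ (p + 1) * w r := by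
    rw [← integral_const_mul, ← integral_const_mul,
      ← integral_sub (iK.const_mul _) (iN.const_mul _)]
    congr 1; ext r; ring
  rw [IE]
  generalize (∫ r in Ioi (0 : ℝ), (deriv Q r ^ 2 + a * Q r ^ 2 / r ^ 2) * w r) = K at *
  generalize (∫ r in Ioi (0 : ℝ), |Q r| ^ (p + 1) * w r) = N at *
  generalize (∫ r in Ioi (0 : ℝ), Q r ^ 2 * w r) = M at *
  have hM : M = N - K := by linarith
  have hd0 : (d:ℝ) ≠ 0 := by linarith
  have hpm : p - 1 ≠ 0 := by linarith
  subst hM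
  have hK : K = (d:ℝ) * (p - 1) / (2 * (p + 1)) * N := by
    field_simp at I2 ⊢
    linarith
  subst hK
  constructor
  · field_simp
    ring
  · field_simp
    ring
end

section
/- Let d ≥ 3 and ν ≥ 0. For f ∈ C_c^∞((0,∞)) complex-valued, define the Hankel transform (𝓗_ν f)(ρ) = ∫₀^∞ (rρ)^{-(d-2)/2} J_ν(rρ) f(r) r^{d-1} dr for ρ > 0. Then 𝓗_ν is an L² isometry: ∫₀^∞ |(𝓗_ν f)(ρ)|² ρ^{d-1} dρ = ∫₀^∞ |f(r)|² r^{d-1} dr. -/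
open MeasureTheory Set

/-- The Bessel function of order `ν > -1/2`, defined for `r > 0` by
`J_ν(r) = ((r/2)^ν / (Γ(ν+1/2)Γ(1/2))) ∫_{-1}^{1} e^{isr} (1-s²)^{(2ν-1)/2} ds`. -/
noncomputable def besselJ (ν : ℝ) (r : ℝ) : ℂ :=
  (((r / 2) ^ ν / (Real.Gamma (ν + 1 / 2) * Real.Gamma (1 / 2)) : ℝ) : ℂ) *
    ∫ s in (-1 : ℝ)..1,
      Complex.exp (Complex.I * (s : ℂ) * (r : ℂ)) * (((1 - s ^ 2) ^ ((2 * ν - 1) / 2) : ℝ) : ℂ)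

/-- The Hankel transform of order `ν` (for radial profiles in dimension `d`):
`(𝓗_ν f)(ρ) = ∫₀^∞ (rρ)^{-(d-2)/2} J_ν(rρ) f(r) r^{d-1} dr`. -/
noncomputable def hankel (d : ℕ) (ν : ℝ) (f : ℝ → ℂ) (ρ : ℝ) : ℂ :=
  ∫ r in Ioi (0 : ℝ),
    (((r * ρ) ^ (-((d : ℝ) - 2) / 2) : ℝ) : ℂ) * besselJ ν (r * ρ) * f r *
      ((r ^ ((d : ℝ) - 1) : ℝ) : ℂ)


lemma beta_aux (α β : ℝ) (hα : 0 < α) (hβ : 0 < β) :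
    IntegrableOn (fun x : ℝ => x ^ (α - 1) * (1 - x) ^ (β - 1)) (Ioo 0 1) ∧
    ∫ x in Ioo (0:ℝ) 1, x ^ (α - 1) * (1 - x) ^ (β - 1) =
      Real.Gamma α * Real.Gamma β / Real.Gamma (α + β) := by
  have hc := Complex.betaIntegral_convergent (u := α) (v := β) (by simpa) (by simpa)
  rw [intervalIntegrable_iff_integrableOn_Ioo_of_le (by simp)] at hc
  have hcongr : ∀ x ∈ Ioo (0:ℝ) 1, (x : ℂ) ^ ((α : ℂ) - 1) * (1 - (x : ℂ)) ^ ((β : ℂ) - 1)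
      = ((x ^ (α - 1) * (1 - x) ^ (β - 1) : ℝ) : ℂ) := by
    intro x hx
    rw [Complex.ofReal_mul, Complex.ofReal_cpow hx.1.le, Complex.ofReal_cpow (by linarith [hx.2])]
    push_cast
    rfl
  have hi : IntegrableOn (fun x : ℝ => x ^ (α - 1) * (1 - x) ^ (β - 1)) (Ioo 0 1) := by
    have := (hc.congr_fun hcongr measurableSet_Ioo).re
    simp only [RCLike.re_to_complex, Complex.ofReal_re] at this
    exact this
  refine ⟨hi, ?_⟩
  have h := Complex.betaIntegral_eq_Gamma_mul_div (α : ℂ) (β : ℂ) (by simpa) (by simpa)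
  rw [Complex.betaIntegral, intervalIntegral.integral_of_le (by simp),
    integral_Ioc_eq_integral_Ioo, setIntegral_congr_fun measurableSet_Ioo hcongr,
    integral_complex_ofReal, ← Complex.ofReal_add] at h
  simp only [Complex.Gamma_ofReal] at h
  exact_mod_cast h

lemma moment_aux (ν : ℝ) (hν : 0 ≤ ν) (k : ℕ) :
    IntegrableOn (fun s : ℝ => s ^ (2 * k) * (1 - s ^ 2) ^ ((2 * ν - 1) / 2)) (Ioo 0 1) ∧
    ∫ s in Ioo (0:ℝ) 1, s ^ (2 * k) * (1 - s ^ 2) ^ ((2 * ν - 1) / 2) =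
      (Real.Gamma (k + 1 / 2) * Real.Gamma (ν + 1 / 2) / Real.Gamma (ν + k + 1)) / 2 := by
  obtain ⟨h1, h2⟩ := beta_aux (k + 1 / 2) (ν + 1 / 2) (by positivity) (by positivity)
  set g : ℝ → ℝ := fun x : ℝ => x ^ ((k + 1 / 2 : ℝ) - 1) * (1 - x) ^ ((ν + 1 / 2) - 1) with hg
  have key : ∀ x ∈ Ioi (0:ℝ), (|(2:ℝ)| * x ^ ((2:ℝ) - 1)) • (Ioo (0:ℝ) 1).indicator g (x ^ (2:ℝ))
      = (Ioo (0:ℝ) 1).indicator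
        (fun s => 2 * (s ^ (2 * k) * (1 - s ^ 2) ^ ((2 * ν - 1) / 2))) x := by
    intro x hx
    have hx0 : (0:ℝ) < x := hx
    by_cases h : x < 1
    · rw [indicator_of_mem (show x ∈ Ioo (0:ℝ) 1 from ⟨hx0, h⟩), indicator_of_mem]
      · have e1 : (x ^ (2:ℝ)) ^ ((k + 1 / 2 : ℝ) - 1) * x = x ^ (2 * k) := by
          rw [← Real.rpow_mul hx0.le, ← Real.rpow_add_one hx0.ne', ← Real.rpow_natCast]
          congr 1; push_cast; ring
        have e2 : (x:ℝ) ^ ((2:ℝ) - 1) = x := by norm_num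
        simp only [hg, smul_eq_mul]
        rw [← e1, e2, Real.rpow_two, show ν + 1 / 2 - 1 = (2 * ν - 1) / 2 by ring]
        norm_num; ring
      · rw [Real.rpow_two]; constructor
        · positivity
        · nlinarith
    · have n1 : x ^ (2:ℝ) ∉ Ioo (0:ℝ) 1 := by
        rw [Real.rpow_two]
        rintro ⟨_, h'⟩
        nlinarith
      have n2 : x ∉ Ioo (0:ℝ) 1 := fun h' => h h'.2
      rw [indicator_of_notMem n1, indicator_of_notMem n2, smul_zero]
  have e0 : Ioo (0:ℝ) 1 ∩ Ioi 0 = Ioo 0 1 := by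
    ext x; simp only [mem_inter_iff, mem_Ioo, mem_Ioi]; tauto
  have e0' : Ioi (0:ℝ) ∩ Ioo (0:ℝ) 1 = Ioo 0 1 := by
    ext x; simp only [mem_inter_iff, mem_Ioo, mem_Ioi]; tauto
  constructor
  · have h3 : IntegrableOn ((Ioo (0:ℝ) 1).indicator g) (Ioi 0) := by
      rw [integrableOn_indicator_iff measurableSet_Ioo, e0]
      exact h1
    rw [← integrableOn_Ioi_comp_rpow_iff _ (two_ne_zero (α := ℝ)),
      integrableOn_congr_fun key measurableSet_Ioi,
      integrableOn_indicator_iff measurableSet_Ioo, e0] at h3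
    have : IntegrableOn (fun x : ℝ => 1 / 2 * (2 * (x ^ (2 * k) * (1 - x ^ 2) ^ ((2 * ν - 1) / 2))))
      (Ioo 0 1) := Integrable.const_mul h3 (1 / 2)
    refine this.congr_fun (fun x _ => ?_) measurableSet_Ioo
    simp only []
    ring
  · have h3 := integral_comp_rpow_Ioi ((Ioo (0:ℝ) 1).indicator g) (two_ne_zero (α := ℝ))
    rw [setIntegral_congr_fun measurableSet_Ioi key, setIntegral_indicator measurableSet_Ioo,
      setIntegral_indicator measurableSet_Ioo, e0', integral_const_mul, h2] at h3
    rw [show ν + k + 1 = k + 1 / 2 + (ν + 1 / 2) by ring, ← h3]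
    ring

lemma gamma_half_aux (k : ℕ) :
    Real.Gamma (k + 1 / 2) = Real.Gamma (1 / 2) * (2 * k).factorial / (4 ^ k * k.factorial) := by
  induction k with
  | zero => simp
  | succ k ih =>
    rw [show ((k + 1 : ℕ) : ℝ) + 1 / 2 = (k + 1 / 2) + 1 by push_cast; ring,
      Real.Gamma_add_one (by positivity), ih, show 2 * (k + 1) = (2 * k + 1) + 1 by ring,
      Nat.factorial_succ, Nat.factorial_succ, Nat.factorial_succ]
    push_cast
    field_simp
    ring

/-- even part -/
lemma bessel_cos (ν : ℝ) (hν : 0 ≤ ν) (r : ℝ) :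
    (∫ s in (-1 : ℝ)..1, Complex.exp (Complex.I * (s : ℂ) * (r : ℂ)) *
      (((1 - s ^ 2) ^ ((2 * ν - 1) / 2) : ℝ) : ℂ)) =
    ((2 * ∫ s in Ioo (0:ℝ) 1, Real.cos (s * r) * (1 - s ^ 2) ^ ((2 * ν - 1) / 2) : ℝ) : ℂ) := by
  have hw : IntervalIntegrable (fun s : ℝ => (1 - s ^ 2) ^ ((2 * ν - 1) / 2)) volume 0 1 := by
    rw [intervalIntegrable_iff_integrableOn_Ioo_of_le zero_le_one]
    simpa using (moment_aux ν hν 0).1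
  have hF : ∀ c : ℝ, IntervalIntegrable (fun s : ℝ => Complex.exp (Complex.I * (s : ℂ) * (c : ℂ)) *
      (((1 - s ^ 2) ^ ((2 * ν - 1) / 2) : ℝ) : ℂ)) volume 0 1 := by
    intro c
    have : IntervalIntegrable (fun s : ℝ => (((1 - s ^ 2) ^ ((2 * ν - 1) / 2) : ℝ) : ℂ))
        volume 0 1 := by
      rw [intervalIntegrable_iff_integrableOn_Ioo_of_le zero_le_one] at hw ⊢
      exact Integrable.ofReal hw
    exact this.continuousOn_mul (by fun_prop)
  have hneg : IntervalIntegrable (fun s : ℝ => Complex.exp (Complex.I * (s : ℂ) * (r : ℂ)) *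
      (((1 - s ^ 2) ^ ((2 * ν - 1) / 2) : ℝ) : ℂ)) volume (-1) 0 := by
    rw [IntervalIntegrable.iff_comp_neg]
    have := (hF (-r)).symm
    simpa using this
  rw [← intervalIntegral.integral_add_adjacent_intervals hneg (hF r)]
  have e1 : (∫ s in (-1 : ℝ)..0, Complex.exp (Complex.I * (s : ℂ) * (r : ℂ)) *
      (((1 - s ^ 2) ^ ((2 * ν - 1) / 2) : ℝ) : ℂ)) = ∫ s in (0 : ℝ)..1,
      Complex.exp (Complex.I * (s : ℂ) * ((-r : ℝ) : ℂ)) *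
      (((1 - s ^ 2) ^ ((2 * ν - 1) / 2) : ℝ) : ℂ) := by
    have := intervalIntegral.integral_comp_neg (a := 0) (b := 1) (fun s : ℝ => Complex.exp (Complex.I * (s : ℂ) * (r : ℂ)) *
      (((1 - s ^ 2) ^ ((2 * ν - 1) / 2) : ℝ) : ℂ))
    rw [neg_zero] at this
    rw [← this]
    simp
  rw [e1, ← intervalIntegral.integral_add (hF (-r)) (hF r), intervalIntegral.integral_of_le zero_le_one,
    integral_Ioc_eq_integral_Ioo, ← integral_const_mul, ← integral_complex_ofReal]
  congr 1
  ext s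
  push_cast
  rw [Complex.cos]
  ring_nf

noncomputable def bcoef (ν : ℝ) (k : ℕ) : ℝ :=
  (-1) ^ k / (k.factorial * Real.Gamma (ν + k + 1))

/-- Power series of the Bessel function. -/
lemma bessel_hasSum (ν : ℝ) (hν : 0 ≤ ν) (x : ℝ) :
    HasSum (fun k : ℕ => (((x / 2) ^ ν * (bcoef ν k * (x / 2) ^ (2 * k)) : ℝ) : ℂ))
      (besselJ ν x) := by
  have hint : HasSum (fun k : ℕ => ∫ s in Ioo (0:ℝ) 1,
      ((-1) ^ k * x ^ (2 * k) / (2 * k).factorial) *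
        (s ^ (2 * k) * (1 - s ^ 2) ^ ((2 * ν - 1) / 2)))
      (∫ s in Ioo (0:ℝ) 1, Real.cos (s * x) * (1 - s ^ 2) ^ ((2 * ν - 1) / 2)) := by
    have hw : IntegrableOn (fun s : ℝ => (1 - s ^ 2) ^ ((2 * ν - 1) / 2)) (Ioo 0 1) := by
      simpa using (moment_aux ν hν 0).1
    have hs : HasSum (fun k : ℕ => |x| ^ (2 * k) / (2 * k).factorial) (Real.cosh |x|) :=
      Real.hasSum_cosh _
    refine hasSum_integral_of_dominated_convergence
      (bound := fun k s => |x| ^ (2 * k) / (2 * k).factorial * (1 - s ^ 2) ^ ((2 * ν - 1) / 2))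
      ?_ ?_ ?_ ?_ ?_
    · intro k
      exact ((moment_aux ν hν k).1.const_mul _).aestronglyMeasurable
    · intro k
      refine ae_restrict_of_forall_mem measurableSet_Ioo (fun s hs => ?_)
      have h1 : 0 ≤ (1 - s ^ 2) ^ ((2 * ν - 1) / 2) :=
        Real.rpow_nonneg (by nlinarith [hs.1, hs.2]) _
      have h2 : s ^ (2 * k) ≤ 1 := pow_le_one₀ hs.1.le hs.2.le
      have h3 : 0 ≤ s ^ (2 * k) := pow_nonneg hs.1.le _
      rw [norm_mul, norm_mul, Real.norm_of_nonneg h1, Real.norm_of_nonneg h3, norm_div, norm_mul,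
        norm_pow, norm_neg, norm_one, one_pow, one_mul, norm_pow, Real.norm_eq_abs]
      simp only [RCLike.norm_natCast]
      gcongr
      exact mul_le_of_le_one_left h1 h2
    · exact Filter.Eventually.of_forall (fun s => (hs.mul_right _).summable)
    · simp_rw [(hs.mul_right _).tsum_eq]
      exact hw.const_mul _
    · refine Filter.Eventually.of_forall (fun s => ?_)
      convert! (Real.hasSum_cos (s * x)).mul_right ((1 - s ^ 2) ^ ((2 * ν - 1) / 2)) using 2 with k
      rw [mul_pow]; ring
  rw [besselJ, bessel_cos ν hν x, ← Complex.ofReal_mul, Complex.hasSum_ofReal]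
  convert! (hint.mul_left 2).mul_left ((x / 2) ^ ν / (Real.Gamma (ν + 1 / 2) * Real.Gamma (1 / 2)))
    using 2 with k
  rw [integral_const_mul, (moment_aux ν hν k).2, gamma_half_aux, bcoef]
  have g1 : Real.Gamma (ν + 1 / 2) ≠ 0 := (Real.Gamma_pos_of_pos (by positivity)).ne'
  have g2 : Real.Gamma (1 / 2) ≠ 0 := (Real.Gamma_pos_of_pos (by positivity)).ne'
  have g3 : Real.Gamma (ν + k + 1) ≠ 0 := (Real.Gamma_pos_of_pos (by positivity)).ne'
  rw [show (4:ℝ) ^ k = 2 ^ (2 * k) by rw [pow_mul]; norm_num, div_pow x]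
  field_simp

lemma bessel_bound (ν : ℝ) (hν : 0 ≤ ν) :
    ∃ C : ℝ, 0 ≤ C ∧ ∀ x : ℝ, 0 < x → ‖besselJ ν x‖ ≤ C * x ^ ν := by
  have hw : IntegrableOn (fun s : ℝ => (1 - s ^ 2) ^ ((2 * ν - 1) / 2)) (Ioo 0 1) := by
    simpa using (moment_aux ν hν 0).1
  set M := ∫ s in Ioo (0:ℝ) 1, (1 - s ^ 2) ^ ((2 * ν - 1) / 2) with hM
  have hM0 : 0 ≤ M := setIntegral_nonneg measurableSet_Ioo fun s hs =>
    Real.rpow_nonneg (by nlinarith [hs.1, hs.2]) _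
  have g1 : 0 < Real.Gamma (ν + 1 / 2) := (Real.Gamma_pos_of_pos (by positivity))
  have g2 : 0 < Real.Gamma (1 / 2) := (Real.Gamma_pos_of_pos (by positivity))
  refine ⟨(1 / 2) ^ ν / (Real.Gamma (ν + 1 / 2) * Real.Gamma (1 / 2)) * (2 * M), by positivity, ?_⟩
  intro x hx
  have hb : ‖∫ s in Ioo (0:ℝ) 1, Real.cos (s * x) * (1 - s ^ 2) ^ ((2 * ν - 1) / 2)‖ ≤ M := by
    refine norm_integral_le_of_norm_le hw ?_
    refine ae_restrict_of_forall_mem measurableSet_Ioo (fun s hs => ?_)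
    have h1 : 0 ≤ (1 - s ^ 2) ^ ((2 * ν - 1) / 2) :=
      Real.rpow_nonneg (by nlinarith [hs.1, hs.2]) _
    rw [norm_mul, Real.norm_of_nonneg h1]
    exact mul_le_of_le_one_left h1 (Real.abs_cos_le_one _)
  rw [besselJ, bessel_cos ν hν x, norm_mul, Complex.norm_real, Complex.norm_real, norm_mul (2:ℝ),
    Real.norm_of_nonneg (by positivity), show x / 2 = 1 / 2 * x by ring,
    Real.mul_rpow (by norm_num) hx.le]
  calc _ ≤ (1 / 2) ^ ν * x ^ ν / (Real.Gamma (ν + 1 / 2) * Real.Gamma (1 / 2)) * (2 * M) := by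
        gcongr
        simp
    _ = _ := by ring

noncomputable def phi (ν a r : ℝ) : ℝ := r ^ (ν + 1 / 2) * Real.exp (-(a / 2) * r ^ 2)

noncomputable def kerJ (ν x : ℝ) : ℂ := ((x ^ (1 / 2 : ℝ) : ℝ) : ℂ) * besselJ ν x

noncomputable def hT (ν : ℝ) (u : ℝ → ℂ) (ρ : ℝ) : ℂ :=
  ∫ r in Ioi (0 : ℝ), kerJ ν (r * ρ) * u r

lemma phi_nonneg (ν a r : ℝ) (hr : 0 < r) : 0 ≤ phi ν a r := by
  unfold phi; positivity

lemma phi_continuous (ν : ℝ) (hν : 0 ≤ ν) (a : ℝ) : Continuous (phi ν a) := by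
  unfold phi
  refine Continuous.mul ?_ (by fun_prop)
  exact Real.continuous_rpow_const (by positivity)

lemma gauss_int (q b : ℝ) (hq : -1 < q) (hb : 0 < b) :
    ∫ x in Ioi (0:ℝ), x ^ q * Real.exp (-b * x ^ 2) =
      b ^ (-((q + 1) / 2)) * (1 / 2) * Real.Gamma ((q + 1) / 2) := by
  have := integral_rpow_mul_exp_neg_mul_rpow (p := 2) two_pos hq hb
  simp only [Real.rpow_two] at this
  rw [this, neg_div]

lemma phi_mul (ν a b r : ℝ) (hr : 0 < r) :
    phi ν a r * phi ν b r = r ^ (2 * ν + 1) * Real.exp (-((a + b) / 2) * r ^ 2) := by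
  unfold phi
  rw [show r ^ (2 * ν + 1) = r ^ (ν + 1 / 2) * r ^ (ν + 1 / 2) by
    rw [← Real.rpow_add hr]; ring_nf,
    show -((a + b) / 2) * r ^ 2 = -(a / 2) * r ^ 2 + -(b / 2) * r ^ 2 by ring, Real.exp_add]
  ring

lemma phi_mul_integrable (ν : ℝ) (hν : 0 ≤ ν) (a b : ℝ) (ha : 0 < a) (hb : 0 < b) :
    IntegrableOn (fun r => phi ν a r * phi ν b r) (Ioi 0) := by
  refine (integrableOn_rpow_mul_exp_neg_mul_sq (b := (a + b) / 2) (by positivity)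
    (s := 2 * ν + 1) (by linarith)).congr_fun (fun r hr => ?_) measurableSet_Ioi
  exact (phi_mul ν a b r hr).symm

lemma phi_mul_int (ν : ℝ) (hν : 0 ≤ ν) (a b : ℝ) (ha : 0 < a) (hb : 0 < b) :
    ∫ r in Ioi (0:ℝ), phi ν a r * phi ν b r =
      ((a + b) / 2) ^ (-(ν + 1)) * (1 / 2) * Real.Gamma (ν + 1) := by
  rw [setIntegral_congr_fun measurableSet_Ioi (fun r hr => phi_mul ν a b r hr),
    gauss_int _ _ (by linarith) (by positivity)]
  ring_nf

lemma phi_iso (ν : ℝ) (hν : 0 ≤ ν) (a b : ℝ) (ha : 0 < a) (hb : 0 < b) :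
    ∫ r in Ioi (0:ℝ), (a ^ (-ν - 1) * phi ν a⁻¹ r) * (b ^ (-ν - 1) * phi ν b⁻¹ r) =
    ∫ r in Ioi (0:ℝ), phi ν a r * phi ν b r := by
  have e : ∀ r, (a ^ (-ν - 1) * phi ν a⁻¹ r) * (b ^ (-ν - 1) * phi ν b⁻¹ r) =
    (a ^ (-ν - 1) * b ^ (-ν - 1)) * (phi ν a⁻¹ r * phi ν b⁻¹ r) := fun r => by ring
  simp_rw [e]
  rw [integral_const_mul, phi_mul_int ν hν _ _ (by positivity) (by positivity),
    phi_mul_int ν hν _ _ ha hb, show -ν - 1 = -(ν + 1) by ring, ← Real.mul_rpow ha.le hb.le,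
    ← mul_assoc, ← mul_assoc, ← Real.mul_rpow (by positivity) (by positivity)]
  congr 3
  field_simp
  ring

lemma besselJ_measurable (ν : ℝ) (hν : 0 ≤ ν) : Measurable (besselJ ν) := by
  refine measurable_of_tendsto_metrizable (f := fun n x => ∑ k ∈ Finset.range n,
    (((x / 2) ^ ν * (bcoef ν k * (x / 2) ^ (2 * k)) : ℝ) : ℂ)) ?_ ?_
  · intro n
    fun_prop
  · rw [tendsto_pi_nhds]
    intro x
    exact (bessel_hasSum ν hν x).tendsto_sum_nat

lemma kerJ_measurable (ν : ℝ) (hν : 0 ≤ ν) : Measurable (kerJ ν) := by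
  unfold kerJ
  have := besselJ_measurable ν hν
  fun_prop

lemma kerJ_bound (ν : ℝ) (hν : 0 ≤ ν) :
    ∃ C : ℝ, 0 ≤ C ∧ ∀ x : ℝ, 0 < x → ‖kerJ ν x‖ ≤ C * x ^ (ν + 1 / 2) := by
  obtain ⟨C, hC, h⟩ := bessel_bound ν hν
  refine ⟨C, hC, fun x hx => ?_⟩
  rw [kerJ, norm_mul, Complex.norm_real, Real.norm_of_nonneg (by positivity), Real.rpow_add hx]
  calc _ ≤ x ^ (1 / 2 : ℝ) * (C * x ^ ν) := by gcongr; exact h x hx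
    _ = _ := by ring

/-- integrability and bound for functions dominated by the Gaussian -/
lemma hT_dom (ν : ℝ) (hν : 0 ≤ ν) (ρ : ℝ) (hρ : 0 < ρ) : ∃ C : ℝ, 0 ≤ C ∧
    ∀ (u : ℝ → ℂ) (M : ℝ), AEStronglyMeasurable u (volume.restrict (Ioi 0)) →
      (∀ r, 0 < r → ‖u r‖ ≤ M * phi ν 1 r) →
      IntegrableOn (fun r => kerJ ν (r * ρ) * u r) (Ioi 0) ∧ ‖hT ν u ρ‖ ≤ C * M := by
  obtain ⟨C, hC, h⟩ := kerJ_bound ν hν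
  have hI : IntegrableOn (fun r : ℝ => r ^ (2 * ν + 1) * Real.exp (-(1 / 2) * r ^ 2)) (Ioi 0) :=
    integrableOn_rpow_mul_exp_neg_mul_sq (by positivity) (by linarith)
  have hI0 : 0 ≤ ∫ r in Ioi (0:ℝ), r ^ (2 * ν + 1) * Real.exp (-(1 / 2) * r ^ 2) :=
    setIntegral_nonneg measurableSet_Ioi fun r hr => by
      have : (0:ℝ) < r := hr
      positivity
  refine ⟨C * ρ ^ (ν + 1 / 2) * ∫ r in Ioi (0:ℝ), r ^ (2 * ν + 1) * Real.exp (-(1 / 2) * r ^ 2),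
    by positivity, ?_⟩
  intro u M hu hM
  have hb : ∀ᵐ r ∂(volume.restrict (Ioi (0:ℝ))), ‖kerJ ν (r * ρ) * u r‖ ≤
      (C * ρ ^ (ν + 1 / 2) * M) * (r ^ (2 * ν + 1) * Real.exp (-(1 / 2) * r ^ 2)) := by
    refine ae_restrict_of_forall_mem measurableSet_Ioi (fun r hr => ?_)
    have hr0 : (0:ℝ) < r := hr
    rw [norm_mul]
    calc _ ≤ (C * (r * ρ) ^ (ν + 1 / 2)) * (M * phi ν 1 r) := by
          gcongr
          · exact h _ (by positivity)
          · exact hM r hr0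
      _ = _ := by
          rw [phi, Real.mul_rpow hr0.le hρ.le, show r ^ (2 * ν + 1) = r ^ (ν + 1 / 2) * r ^ (ν + 1 / 2) by
            rw [← Real.rpow_add hr0]; ring_nf]
          ring
  have hI' := Integrable.const_mul hI (C * ρ ^ (ν + 1 / 2) * M)
  constructor
  · refine Integrable.mono' hI' ?_ hb
    exact ((kerJ_measurable ν hν).comp (measurable_id.mul_const ρ)).aestronglyMeasurable.mul hu
  · refine (norm_integral_le_of_norm_le hI' hb).trans (le_of_eq ?_)
    rw [integral_const_mul]
    ring

lemma hT_gauss (ν : ℝ) (hν : 0 ≤ ν) (a : ℝ) (ha : 0 < a) (ρ : ℝ) (hρ : 0 < ρ) :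
    hT ν (fun r => ((phi ν a r : ℝ) : ℂ)) ρ = ((a ^ (-ν - 1) * phi ν a⁻¹ ρ : ℝ) : ℂ) := by
  set D : ℕ → ℝ := fun k => ρ ^ (ν + 1 / 2) * (1 / 2) ^ ν * (bcoef ν k * (ρ / 2) ^ (2 * k)) with hD
  set G : ℕ → ℝ → ℝ := fun k r => r ^ (2 * ν + 2 * k + 1) * Real.exp (-(a / 2) * r ^ 2) with hG
  have hGi : ∀ k, IntegrableOn (G k) (Ioi 0) := fun k =>
    integrableOn_rpow_mul_exp_neg_mul_sq (by positivity) (by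
      have : (0:ℝ) ≤ k := by positivity
      linarith)
  have hGI : ∀ k, ∫ r in Ioi (0:ℝ), G k r =
      (a / 2) ^ (-(ν + 1)) * ((2 / a) ^ k) * (1 / 2) * Real.Gamma (ν + k + 1) := by
    intro k
    have hk : (0:ℝ) ≤ k := by positivity
    simp only [hG]
    rw [gauss_int _ _ (by linarith) (by positivity),
      show (2 * ν + 2 * k + 1 + 1) / 2 = ν + k + 1 by ring,
      show -(ν + k + 1) = -(ν + 1) + -(k:ℝ) by ring, Real.rpow_add (by positivity),
      Real.rpow_neg (by positivity) (k:ℝ), Real.rpow_natCast, ← inv_pow, inv_div]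
  have hG0 : ∀ k, ∀ r ∈ Ioi (0:ℝ), 0 ≤ G k r := by
    intro k r hr
    have : (0:ℝ) < r := hr
    simp only [hG]; positivity
  have hfin : ∀ k, D k * ∫ r in Ioi (0:ℝ), G k r =
      (a ^ (-ν - 1) * ρ ^ (ν + 1 / 2)) * ((-(a⁻¹ / 2) * ρ ^ 2) ^ k / k.factorial) := by
    intro k
    have g3 : Real.Gamma (ν + k + 1) ≠ 0 := (Real.Gamma_pos_of_pos (by positivity)).ne'
    have e1 : (a / 2) ^ (-(ν + 1)) = a ^ (-ν - 1) * (1 / 2) ^ (-ν) * 2 := by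
      rw [div_eq_mul_one_div, Real.mul_rpow ha.le (by norm_num), show -(ν + 1) = -ν - 1 by ring,
        Real.rpow_sub_one (by norm_num : (1 / 2 : ℝ) ≠ 0)]
      ring
    have e2 : (1 / 2 : ℝ) ^ ν * (1 / 2) ^ (-ν) = 1 := by
      rw [← Real.rpow_add (by norm_num)]; simp
    have e3 : (-(a⁻¹ / 2) * ρ ^ 2) ^ k = (-1) ^ k * (ρ / 2) ^ (2 * k) * (2 / a) ^ k := by
      rw [pow_mul, ← mul_pow, ← mul_pow]
      congr 1; field_simp
    rw [hGI, e1, e3]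
    simp only [hD, bcoef]
    calc _ = ((1 / 2 : ℝ) ^ ν * (1 / 2) ^ (-ν)) * (a ^ (-ν - 1) * ρ ^ (ν + 1 / 2) *
          ((-1) ^ k * (ρ / 2) ^ (2 * k) * (2 / a) ^ k / k.factorial)) *
            (Real.Gamma (ν + k + 1) / Real.Gamma (ν + k + 1)) := by
          field_simp
      _ = _ := by rw [e2, div_self g3]; ring
  have hsum : HasSum (fun k => D k * ∫ r in Ioi (0:ℝ), G k r)
      (a ^ (-ν - 1) * phi ν a⁻¹ ρ) := by
    simp_rw [hfin]
    rw [phi, ← mul_assoc]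
    refine HasSum.mul_left _ ?_
    have := NormedSpace.expSeries_div_hasSum_exp (𝔸 := ℝ) (-(a⁻¹ / 2) * ρ ^ 2)
    rwa [← Real.exp_eq_exp_ℝ] at this
  have hmain := hasSum_integral_of_summable_integral_norm (μ := volume.restrict (Ioi (0:ℝ)))
    (F := fun k r => ((D k * G k r : ℝ) : ℂ))
    (fun k => (Integrable.const_mul (hGi k) (D k)).ofReal) (by
      have : ∀ k, ∫ r in Ioi (0:ℝ), ‖((D k * G k r : ℝ) : ℂ)‖ =
          |D k * ∫ r in Ioi (0:ℝ), G k r| := by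
        intro k
        rw [abs_mul, abs_of_nonneg (setIntegral_nonneg measurableSet_Ioi (hG0 k)),
          ← integral_const_mul]
        refine setIntegral_congr_fun measurableSet_Ioi (fun r hr => ?_)
        rw [Complex.norm_real, Real.norm_eq_abs, abs_mul, abs_of_nonneg (hG0 k r hr)]
      simp_rw [this]
      exact hsum.summable.abs)
  have hts : ∀ r ∈ Ioi (0:ℝ), (∑' k, ((D k * G k r : ℝ) : ℂ)) =
      kerJ ν (r * ρ) * ((phi ν a r : ℝ) : ℂ) := by
    intro r hr
    have hr0 : (0:ℝ) < r := hr
    have := ((bessel_hasSum ν hν (r * ρ)).mul_left (((r * ρ) ^ (1 / 2 : ℝ) : ℝ) : ℂ)).mul_right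
      ((phi ν a r : ℝ) : ℂ)
    rw [kerJ, ← this.tsum_eq]
    congr 1
    ext k
    rw [← Complex.ofReal_mul, ← Complex.ofReal_mul, Complex.ofReal_inj]
    simp only [hD, hG, phi]
    rw [show r * ρ / 2 = r * ρ * (1 / 2) by ring, Real.mul_rpow (z := ν) (mul_nonneg hr0.le hρ.le) (by norm_num),
      Real.mul_rpow (z := ν) hr0.le hρ.le, Real.mul_rpow (z := 1 / 2) hr0.le hρ.le,
      show r ^ (2 * ν + 2 * k + 1) = r ^ (1 / 2 : ℝ) * r ^ ν * r ^ (2 * k) * r ^ (ν + 1 / 2) by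
        rw [← Real.rpow_natCast r (2 * k), ← Real.rpow_add hr0, ← Real.rpow_add hr0,
          ← Real.rpow_add hr0]
        congr 1; push_cast; ring,
      show ρ ^ (ν + 1 / 2) = ρ ^ (1 / 2 : ℝ) * ρ ^ ν by
        rw [← Real.rpow_add hρ]; ring_nf]
    ring
  rw [setIntegral_congr_fun measurableSet_Ioi hts] at hmain
  have hreal : ∀ k, ∫ r in Ioi (0:ℝ), ((D k * G k r : ℝ) : ℂ) =
      ((D k * ∫ r in Ioi (0:ℝ), G k r : ℝ) : ℂ) := by
    intro k
    rw [integral_complex_ofReal, integral_const_mul]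
  simp_rw [hreal] at hmain
  exact hmain.unique (Complex.hasSum_ofReal.mpr hsum)

lemma sq_sum_int (s : Finset ℕ) (c : ℕ → ℂ) (a : ℕ → ℝ → ℝ)
    (hi : ∀ k l, IntegrableOn (fun r => a k r * a l r) (Ioi 0)) :
    ∫ r in Ioi (0:ℝ), ‖∑ k ∈ s, c k * (a k r : ℂ)‖ ^ 2 =
      ∑ k ∈ s, ∑ l ∈ s, (c k * (starRingEnd ℂ) (c l)).re *
        ∫ r in Ioi (0:ℝ), a k r * a l r := by
  have e : ∀ r, ‖∑ k ∈ s, c k * (a k r : ℂ)‖ ^ 2 =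
      ∑ k ∈ s, ∑ l ∈ s, (c k * (starRingEnd ℂ) (c l)).re * (a k r * a l r) := by
    intro r
    have h1 : ((‖∑ k ∈ s, c k * (a k r : ℂ)‖ ^ 2 : ℝ) : ℂ) =
        ∑ k ∈ s, ∑ l ∈ s, (c k * (starRingEnd ℂ) (c l)) * ((a k r * a l r : ℝ) : ℂ) := by
      push_cast
      rw [← Complex.mul_conj', map_sum, Finset.sum_mul_sum]
      refine Finset.sum_congr rfl fun k _ => Finset.sum_congr rfl fun l _ => ?_
      rw [map_mul, Complex.conj_ofReal]
      ring
    have h2 := congrArg Complex.re h1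
    rw [Complex.ofReal_re] at h2
    rw [h2, Complex.re_sum]
    refine Finset.sum_congr rfl fun k _ => ?_
    rw [Complex.re_sum]
    refine Finset.sum_congr rfl fun l _ => ?_
    rw [Complex.re_mul_ofReal]
  simp_rw [e]
  rw [integral_finsetSum _ (fun k _ => integrable_finsetSum _ fun l _ =>
    Integrable.const_mul (hi k l) _)]
  refine Finset.sum_congr rfl fun k _ => ?_
  rw [integral_finsetSum _ (fun l _ => Integrable.const_mul (hi k l) _)]
  refine Finset.sum_congr rfl fun l _ => ?_
  rw [integral_const_mul]

/-- Gaussian times polynomial in Gaussian -/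
noncomputable def gP (ν : ℝ) (p : Polynomial ℂ) (r : ℝ) : ℂ :=
  (phi ν 1 r : ℂ) * p.eval ((Real.exp (-(1 / 2) * r ^ 2) : ℝ) : ℂ)

noncomputable def gQ (ν : ℝ) (p : Polynomial ℂ) (r : ℝ) : ℂ :=
  ∑ k ∈ p.support, p.coeff k *
    (((k + 1 : ℝ) ^ (-ν - 1) * phi ν (k + 1 : ℝ)⁻¹ r : ℝ) : ℂ)

lemma gP_eq (ν : ℝ) (p : Polynomial ℂ) (r : ℝ) :
    gP ν p r = ∑ k ∈ p.support, p.coeff k * ((phi ν (k + 1 : ℝ) r : ℝ) : ℂ) := by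
  rw [gP, Polynomial.eval_eq_sum, Polynomial.sum, Finset.mul_sum]
  refine Finset.sum_congr rfl fun k _ => ?_
  have : phi ν (k + 1 : ℝ) r = phi ν 1 r * Real.exp (-(1 / 2) * r ^ 2) ^ k := by
    rw [phi, phi, ← Real.exp_nat_mul, mul_assoc, ← Real.exp_add]
    ring_nf
  rw [this]
  push_cast
  ring

lemma gP_continuous (ν : ℝ) (hν : 0 ≤ ν) (p : Polynomial ℂ) : Continuous (gP ν p) := by
  have h := phi_continuous ν hν 1
  have h2 := p.continuous
  unfold gP
  refine (Complex.continuous_ofReal.comp h).mul (h2.comp ?_)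
  fun_prop

lemma gQ_continuous (ν : ℝ) (hν : 0 ≤ ν) (p : Polynomial ℂ) : Continuous (gQ ν p) := by
  have h := phi_continuous ν hν
  unfold gQ
  refine continuous_finsetSum _ fun k _ => ?_
  exact continuous_const.mul (Complex.continuous_ofReal.comp (continuous_const.mul (h _)))

lemma gP_sub (ν : ℝ) (p q : Polynomial ℂ) (r : ℝ) : gP ν (p - q) r = gP ν p r - gP ν q r := by
  simp [gP, mul_sub]

lemma phi_le (ν : ℝ) (k : ℕ) (r : ℝ) (hr : 0 < r) : phi ν (k + 1 : ℝ) r ≤ phi ν 1 r := by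
  unfold phi
  gcongr
  have : (0:ℝ) ≤ k := by positivity
  linarith

lemma gP_bound (ν : ℝ) (p : Polynomial ℂ) :
    ∃ M : ℝ, 0 ≤ M ∧ ∀ r, 0 < r → ‖gP ν p r‖ ≤ M * phi ν 1 r := by
  refine ⟨∑ k ∈ p.support, ‖p.coeff k‖, by positivity, fun r hr => ?_⟩
  rw [gP_eq, Finset.sum_mul]
  refine norm_sum_le_of_le _ fun k _ => ?_
  rw [norm_mul, Complex.norm_real, Real.norm_of_nonneg (phi_nonneg _ _ _ hr)]
  gcongr
  exact phi_le ν k r hr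

lemma hT_gP (ν : ℝ) (hν : 0 ≤ ν) (p : Polynomial ℂ) (ρ : ℝ) (hρ : 0 < ρ) :
    hT ν (gP ν p) ρ = gQ ν p ρ := by
  obtain ⟨C, hC, h⟩ := hT_dom ν hν ρ hρ
  rw [hT, gQ]
  have e : ∀ r, kerJ ν (r * ρ) * gP ν p r =
      ∑ k ∈ p.support, p.coeff k * (kerJ ν (r * ρ) * ((phi ν (k + 1 : ℝ) r : ℝ) : ℂ)) := by
    intro r
    rw [gP_eq, Finset.mul_sum]
    refine Finset.sum_congr rfl fun k _ => ?_
    ring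
  simp_rw [e]
  rw [integral_finsetSum]
  · refine Finset.sum_congr rfl fun k _ => ?_
    rw [integral_const_mul, ← hT_gauss ν hν _ (by positivity) ρ hρ]
    rfl
  · intro k _
    refine Integrable.const_mul (h _ 1 ?_ ?_).1 _
    · exact (Complex.continuous_ofReal.comp (phi_continuous ν hν _)).aestronglyMeasurable
    · intro r hr
      rw [Complex.norm_real, Real.norm_of_nonneg (phi_nonneg _ _ _ hr), one_mul]
      exact phi_le ν k r hr

lemma gQ_iso (ν : ℝ) (hν : 0 ≤ ν) (p : Polynomial ℂ) :
    ∫ r in Ioi (0:ℝ), ‖gQ ν p r‖ ^ 2 = ∫ r in Ioi (0:ℝ), ‖gP ν p r‖ ^ 2 := by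
  simp_rw [gP_eq, gQ]
  rw [sq_sum_int _ _ (fun k r => phi ν (k + 1 : ℝ) r)
      (fun k l => phi_mul_integrable ν hν _ _ (by positivity) (by positivity)),
    sq_sum_int _ _ (fun k r => (k + 1 : ℝ) ^ (-ν - 1) * phi ν (k + 1 : ℝ)⁻¹ r)]
  · refine Finset.sum_congr rfl fun k _ => Finset.sum_congr rfl fun l _ => ?_
    rw [phi_iso ν hν _ _ (by positivity) (by positivity)]
  · intro k l
    have := Integrable.const_mul (phi_mul_integrable ν hν (k + 1 : ℝ)⁻¹ (l + 1 : ℝ)⁻¹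
      (by positivity) (by positivity)) ((k + 1 : ℝ) ^ (-ν - 1) * (l + 1 : ℝ) ^ (-ν - 1))
    refine this.congr (Filter.Eventually.of_forall fun r => ?_)
    simp only []
    ring

lemma phi_memLp (ν : ℝ) (hν : 0 ≤ ν) (a : ℝ) (ha : 0 < a) :
    MemLp (fun r => ((phi ν a r : ℝ) : ℂ)) 2 (volume.restrict (Ioi 0)) := by
  have hm : AEStronglyMeasurable (fun r => ((phi ν a r : ℝ) : ℂ)) (volume.restrict (Ioi 0)) :=
    (Complex.continuous_ofReal.comp (phi_continuous ν hν a)).aestronglyMeasurable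
  rw [memLp_two_iff_integrable_sq_norm hm]
  refine (phi_mul_integrable ν hν a a ha ha).congr (Filter.Eventually.of_forall fun r => ?_)
  simp only [Complex.norm_real, Real.norm_eq_abs, sq_abs]
  ring

lemma gP_memLp (ν : ℝ) (hν : 0 ≤ ν) (p : Polynomial ℂ) :
    MemLp (gP ν p) 2 (volume.restrict (Ioi 0)) := by
  have : gP ν p = fun r => ∑ k ∈ p.support, p.coeff k * ((phi ν (k + 1 : ℝ) r : ℝ) : ℂ) :=
    funext (gP_eq ν p)
  rw [this]
  exact memLp_finsetSum _ fun k _ => (phi_memLp ν hν _ (by positivity)).const_mul _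

lemma gQ_memLp (ν : ℝ) (hν : 0 ≤ ν) (p : Polynomial ℂ) :
    MemLp (gQ ν p) 2 (volume.restrict (Ioi 0)) := by
  unfold gQ
  simp_rw [Complex.ofReal_mul]
  exact memLp_finsetSum _ fun k _ =>
    ((phi_memLp ν hν _ (by positivity)).const_mul _).const_mul _

lemma eLp_two {μ : Measure ℝ} {f : ℝ → ℂ} (hf : MemLp f 2 μ) :
    eLpNorm f 2 μ = ENNReal.ofReal ((∫ r, ‖f r‖ ^ 2 ∂μ) ^ (2⁻¹ : ℝ)) := by
  rw [hf.eLpNorm_eq_integral_rpow_norm (by norm_num) (by norm_num)]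
  simp

lemma gQ_norm (ν : ℝ) (hν : 0 ≤ ν) (p : Polynomial ℂ) :
    eLpNorm (gQ ν p) 2 (volume.restrict (Ioi 0)) =
      eLpNorm (gP ν p) 2 (volume.restrict (Ioi 0)) := by
  rw [eLp_two (gQ_memLp ν hν p), eLp_two (gP_memLp ν hν p), gQ_iso ν hν p]

lemma hT_iso (ν : ℝ) (hν : 0 ≤ ν) (u : ℝ → ℂ)
    (hu : AEStronglyMeasurable u (volume.restrict (Ioi 0)))
    (hp : ∀ ε : ℝ, 0 < ε → ∃ p : Polynomial ℂ, ∀ r, 0 < r → ‖u r - gP ν p r‖ ≤ ε * phi ν 1 r) :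
    ∫ r in Ioi (0:ℝ), ‖hT ν u r‖ ^ 2 = ∫ r in Ioi (0:ℝ), ‖u r‖ ^ 2 := by
  set μ : Measure ℝ := volume.restrict (Ioi 0) with hμ
  set ε : ℕ → ℝ := fun n => 1 / ((n : ℝ) + 1) with hε
  have hε0 : ∀ n, 0 < ε n := fun n => by simp only [hε]; positivity
  have hεlim : Filter.Tendsto ε Filter.atTop (nhds 0) := tendsto_one_div_add_atTop_nhds_zero_nat
  choose p hp using fun n => hp (ε n) (hε0 n)
  set K : ENNReal := eLpNorm (fun r => ((phi ν 1 r : ℝ) : ℂ)) 2 μ with hK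
  have hKfin : K ≠ ⊤ := (phi_memLp ν hν 1 one_pos).2.ne
  have hPm : ∀ q : Polynomial ℂ, AEStronglyMeasurable (gP ν q) μ :=
    fun q => (gP_continuous ν hν q).aestronglyMeasurable
  have hQm : ∀ q : Polynomial ℂ, AEStronglyMeasurable (gQ ν q) μ :=
    fun q => (gQ_continuous ν hν q).aestronglyMeasurable
  -- domination gives norm bound
  have hdom : ∀ (v : ℝ → ℂ) (M : ℝ), (∀ r, 0 < r → ‖v r‖ ≤ M * phi ν 1 r) →
      eLpNorm v 2 μ ≤ ENNReal.ofReal M * K := by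
    intro v M hv
    refine eLpNorm_le_mul_eLpNorm_of_ae_le_mul ?_ 2
    refine ae_restrict_of_forall_mem measurableSet_Ioi (fun r hr => ?_)
    rw [Complex.norm_real, Real.norm_of_nonneg (phi_nonneg _ _ _ hr)]
    exact hv r hr
  have h1 : ∀ n, eLpNorm (u - gP ν (p n)) 2 μ ≤ ENNReal.ofReal (ε n) * K :=
    fun n => hdom _ _ (hp n)
  -- pointwise convergence
  have hlim : ∀ ρ, 0 < ρ → Filter.Tendsto (fun n => gQ ν (p n) ρ) Filter.atTop
      (nhds (hT ν u ρ)) := by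
    intro ρ hρ
    obtain ⟨C, hC, h⟩ := hT_dom ν hν ρ hρ
    rw [tendsto_iff_norm_sub_tendsto_zero]
    refine squeeze_zero (fun n => norm_nonneg _) (g := fun n => C * ε n) (fun n => ?_)
      (by simpa using hεlim.const_mul C)
    have hd := h (fun r => u r - gP ν (p n) r) (ε n) (hu.sub (hPm _)) (hp n)
    obtain ⟨M, hM0, hM⟩ := gP_bound ν (p n)
    have hd2 := h (gP ν (p n)) M (hPm _) hM
    have hd3 : IntegrableOn (fun r => kerJ ν (r * ρ) * u r) (Ioi 0) := by
      refine (h u (ε n + M) hu fun r hr => ?_).1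
      calc ‖u r‖ = ‖(u r - gP ν (p n) r) + gP ν (p n) r‖ := by simp
        _ ≤ _ := norm_add_le _ _
        _ ≤ ε n * phi ν 1 r + M * phi ν 1 r := add_le_add (hp n r hr) (hM r hr)
        _ = _ := by ring
    have e : hT ν (fun r => u r - gP ν (p n) r) ρ = hT ν u ρ - gQ ν (p n) ρ := by
      rw [← hT_gP ν hν _ ρ hρ, hT, hT, hT, ← integral_sub hd3 hd2.1]
      simp_rw [mul_sub]
    rw [norm_sub_rev, ← e]
    exact hd.2
  have hTm : AEStronglyMeasurable (hT ν u) μ :=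
    aestronglyMeasurable_of_tendsto_ae Filter.atTop (fun n => hQm (p n))
      (ae_restrict_of_forall_mem measurableSet_Ioi (fun r hr => hlim r hr))
  have hQsub : ∀ n m, ∀ r, 0 < r → gQ ν (p m - p n) r = gQ ν (p m) r - gQ ν (p n) r := by
    intro n m ρ hρ
    obtain ⟨C, hC, h⟩ := hT_dom ν hν ρ hρ
    obtain ⟨M, hM0, hM⟩ := gP_bound ν (p n)
    obtain ⟨M', hM0', hM'⟩ := gP_bound ν (p m)
    rw [← hT_gP ν hν _ ρ hρ, ← hT_gP ν hν _ ρ hρ, ← hT_gP ν hν _ ρ hρ, hT, hT, hT,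
      ← integral_sub (h _ _ (hPm _) hM').1 (h _ _ (hPm _) hM).1]
    simp_rw [gP_sub, mul_sub]
  have h2 : ∀ n, eLpNorm (hT ν u - gQ ν (p n)) 2 μ ≤ ENNReal.ofReal (2 * ε n) * K := by
    intro n
    have hl := Lp.eLpNorm_lim_le_liminf_eLpNorm (μ := μ) (p := 2)
      (f := fun m => gQ ν (p m) - gQ ν (p n)) (fun m => (hQm _).sub (hQm _))
      (hT ν u - gQ ν (p n))
      (ae_restrict_of_forall_mem measurableSet_Ioi
        (fun r hr => (hlim r hr).sub tendsto_const_nhds))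
    refine hl.trans ?_
    refine Filter.liminf_le_of_le (by isBoundedDefault) ?_
    intro b hb
    obtain ⟨N, hN⟩ := Filter.eventually_atTop.mp hb
    refine (hN (max N n) (le_max_left _ _)).trans ?_
    set m := max N n with hm
    have hmn : ε m ≤ ε n := by
      simp only [hε]
      have : (n:ℝ) ≤ m := by exact_mod_cast le_max_right N n
      gcongr
    have e1 : eLpNorm (gQ ν (p m) - gQ ν (p n)) 2 μ = eLpNorm (gQ ν (p m - p n)) 2 μ :=
      eLpNorm_congr_ae (ae_restrict_of_forall_mem measurableSet_Ioi
        (fun r hr => (hQsub n m r hr).symm))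
    rw [e1, gQ_norm ν hν]
    refine hdom _ _ fun r hr => ?_
    rw [gP_sub]
    calc ‖gP ν (p m) r - gP ν (p n) r‖ = ‖(u r - gP ν (p n) r) - (u r - gP ν (p m) r)‖ := by
          congr 1; ring
      _ ≤ _ := norm_sub_le _ _
      _ ≤ ε n * phi ν 1 r + ε m * phi ν 1 r := add_le_add (hp n r hr) (hp m r hr)
      _ ≤ ε n * phi ν 1 r + ε n * phi ν 1 r := by
          have := phi_nonneg ν 1 r hr
          gcongr
      _ = _ := by ring
  have hz : ∀ c : ℝ, ∀ a : ENNReal, Filter.Tendsto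
      (fun n => ENNReal.ofReal (2 * ε n) * K + (ENNReal.ofReal (ε n) * K + a))
      Filter.atTop (nhds a) := by
    intro c a
    have t1 : Filter.Tendsto (fun n => ENNReal.ofReal (2 * ε n) * K) Filter.atTop (nhds 0) := by
      have := ENNReal.Tendsto.mul_const (b := K)
        (ENNReal.tendsto_ofReal (hεlim.const_mul 2)) (Or.inr hKfin)
      simpa using this
    have t2 : Filter.Tendsto (fun n => ENNReal.ofReal (ε n) * K) Filter.atTop (nhds 0) := by
      have := ENNReal.Tendsto.mul_const (b := K)
        (ENNReal.tendsto_ofReal hεlim) (Or.inr hKfin)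
      simpa using this
    simpa using t1.add (t2.add_const a)
  have le1 : eLpNorm (hT ν u) 2 μ ≤ eLpNorm u 2 μ := by
    refine ge_of_tendsto' (hz 0 (eLpNorm u 2 μ)) fun n => ?_
    calc eLpNorm (hT ν u) 2 μ = eLpNorm ((hT ν u - gQ ν (p n)) + gQ ν (p n)) 2 μ := by
          rw [sub_add_cancel]
      _ ≤ eLpNorm (hT ν u - gQ ν (p n)) 2 μ + eLpNorm (gQ ν (p n)) 2 μ :=
          eLpNorm_add_le (hTm.sub (hQm _)) (hQm _) (by norm_num)
      _ = eLpNorm (hT ν u - gQ ν (p n)) 2 μ + eLpNorm (u - (u - gP ν (p n))) 2 μ := by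
          rw [gQ_norm ν hν, sub_sub_cancel]
      _ ≤ eLpNorm (hT ν u - gQ ν (p n)) 2 μ +
          (eLpNorm u 2 μ + eLpNorm (u - gP ν (p n)) 2 μ) := by
          gcongr
          exact eLpNorm_sub_le hu (hu.sub (hPm _)) (by norm_num)
      _ ≤ _ := by
          rw [add_comm (eLpNorm u 2 μ)]
          gcongr
          · exact h2 n
          · exact h1 n
  have le2 : eLpNorm u 2 μ ≤ eLpNorm (hT ν u) 2 μ := by
    refine ge_of_tendsto' (hz 0 (eLpNorm (hT ν u) 2 μ)) fun n => ?_
    calc eLpNorm u 2 μ = eLpNorm ((u - gP ν (p n)) + gP ν (p n)) 2 μ := by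
          rw [sub_add_cancel]
      _ ≤ eLpNorm (u - gP ν (p n)) 2 μ + eLpNorm (gP ν (p n)) 2 μ :=
          eLpNorm_add_le (hu.sub (hPm _)) (hPm _) (by norm_num)
      _ = eLpNorm (u - gP ν (p n)) 2 μ + eLpNorm (hT ν u - (hT ν u - gQ ν (p n))) 2 μ := by
          rw [← gQ_norm ν hν, sub_sub_cancel]
      _ ≤ eLpNorm (u - gP ν (p n)) 2 μ +
          (eLpNorm (hT ν u) 2 μ + eLpNorm (hT ν u - gQ ν (p n)) 2 μ) := by
          gcongr
          exact eLpNorm_sub_le hTm (hTm.sub (hQm _)) (by norm_num)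
      _ ≤ ENNReal.ofReal (ε n) * K + (eLpNorm (hT ν u) 2 μ + ENNReal.ofReal (2 * ε n) * K) := by
          gcongr
          · exact h1 n
          · exact h2 n
      _ = _ := by ring
  have heq := le_antisymm le1 le2
  have hum : MemLp u 2 μ := by
    have : MemLp ((u - gP ν (p 0)) + gP ν (p 0)) 2 μ := by
      refine MemLp.add ⟨hu.sub (hPm _), (h1 0).trans_lt ?_⟩ (gP_memLp ν hν _)
      exact ENNReal.mul_lt_top ENNReal.ofReal_lt_top hKfin.lt_top
    rwa [sub_add_cancel] at this
  have hTmem : MemLp (hT ν u) 2 μ := ⟨hTm, heq ▸ hum.2⟩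
  rw [eLp_two hTmem, eLp_two hum] at heq
  have i1 : 0 ≤ ∫ r, ‖hT ν u r‖ ^ 2 ∂μ := integral_nonneg fun r => by positivity
  have i2 : 0 ≤ ∫ r, ‖u r‖ ^ 2 ∂μ := integral_nonneg fun r => by positivity
  rw [ENNReal.ofReal_eq_ofReal_iff (by positivity) (by positivity)] at heq
  exact (Real.rpow_left_inj i1 i2 (by norm_num)).mp heq

lemma exists_poly (w : ℝ → ℂ) (hw : Continuous w) (hc : HasCompactSupport w) (h0 : w 0 = 0)
    (ε : ℝ) (hε : 0 < ε) : ∃ p : Polynomial ℂ, ∀ r, 0 < r →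
      ‖w r - p.eval ((Real.exp (-(1 / 2) * r ^ 2) : ℝ) : ℂ)‖ ≤ ε := by
  set h : ℝ → ℂ := fun y => w (Real.sqrt (-2 * Real.log y)) with hh
  have hcont : Continuous h := by
    rw [continuous_iff_continuousAt]
    intro y
    by_cases hy : y = 0
    · subst hy
      have hev : ∀ᶠ x in nhdsWithin (0:ℝ) {0}ᶜ, h x = 0 := by
        have ht : Filter.Tendsto (fun y => Real.sqrt (-2 * Real.log y)) (nhdsWithin (0:ℝ) {0}ᶜ)
            Filter.atTop :=
          Real.tendsto_sqrt_atTop.comp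
            (Real.tendsto_log_nhdsNE_zero.const_mul_atBot_of_neg (by norm_num))
        have hev : ∀ᶠ x in Filter.atTop, w x = 0 := by
          obtain ⟨R, hR⟩ := hc.isCompact.isBounded.subset_closedBall 0
          filter_upwards [Filter.eventually_gt_atTop R] with x hx
          by_contra hne
          have := hR (subset_tsupport _ hne)
          rw [mem_closedBall_zero_iff, Real.norm_eq_abs] at this
          linarith [le_abs_self x]
        exact ht.eventually hev
      have h00 : h 0 = 0 := by simp [hh, h0]
      rw [continuousAt_iff_punctured_nhds, h00]
      exact tendsto_const_nhds.congr' (hev.mono fun x hx => hx.symm)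
    · refine hw.continuousAt.comp ?_
      have := Real.continuousAt_log hy
      exact Real.continuous_sqrt.continuousAt.comp (continuousAt_const.mul this)
  obtain ⟨p1, hp1⟩ := exists_polynomial_near_of_continuousOn 0 1 (fun y => (h y).re)
    (Complex.continuous_re.comp hcont).continuousOn (ε / 2) (by positivity)
  obtain ⟨p2, hp2⟩ := exists_polynomial_near_of_continuousOn 0 1 (fun y => (h y).im)
    (Complex.continuous_im.comp hcont).continuousOn (ε / 2) (by positivity)
  refine ⟨p1.map Complex.ofRealHom + Polynomial.C Complex.I * p2.map Complex.ofRealHom, ?_⟩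
  intro r hr
  set y := Real.exp (-(1 / 2) * r ^ 2) with hy
  have hyI : y ∈ Icc (0:ℝ) 1 := ⟨(Real.exp_pos _).le, by
    rw [hy, Real.exp_le_one_iff]; nlinarith [sq_nonneg r]⟩
  have hw' : w r = h y := by
    simp only [hh, hy, Real.log_exp]
    rw [show -2 * (-(1 / 2) * r ^ 2) = r ^ 2 by ring, Real.sqrt_sq hr.le]
  have ev : ∀ q : Polynomial ℝ, (q.map Complex.ofRealHom).eval (y : ℂ) = ((q.eval y : ℝ) : ℂ) := by
    intro q
    have := Polynomial.eval_map_apply (f := Complex.ofRealHom) (p := q) y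
    simpa using this
  rw [hw', Polynomial.eval_add, Polynomial.eval_mul, Polynomial.eval_C, ev, ev]
  have e : h y - (((p1.eval y : ℝ) : ℂ) + Complex.I * ((p2.eval y : ℝ) : ℂ)) =
      (((h y).re - p1.eval y : ℝ) : ℂ) + (((h y).im - p2.eval y : ℝ) : ℂ) * Complex.I := by
    conv_lhs => rw [← Complex.re_add_im (h y)]
    push_cast
    ring
  rw [e]
  refine (norm_add_le _ _).trans ?_
  rw [norm_mul, Complex.norm_I, mul_one, Complex.norm_real, Complex.norm_real, Real.norm_eq_abs,
    Real.norm_eq_abs, abs_sub_comm, abs_sub_comm (h y).im]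
  linarith [hp1 y hyI, hp2 y hyI]

/-- The Hankel transform is an `L²` isometry (Lemma 2.5(iii)) on radial profiles:
`∫₀^∞ |(𝓗_ν f)(ρ)|² ρ^{d-1} dρ = ∫₀^∞ |f(r)|² r^{d-1} dr` for `f ∈ C_c^∞((0,∞))`. -/
theorem hankel_isometry (d : ℕ) (hd : 3 ≤ d) (ν : ℝ) (hν : 0 ≤ ν)
    (f : ℝ → ℂ) (hf : ContDiff ℝ (⊤ : ℕ∞) f) (hsupp : HasCompactSupport f)
    (hsupp' : tsupport f ⊆ Ioi 0) :
    (∫ ρ in Ioi (0 : ℝ), ‖hankel d ν f ρ‖ ^ 2 * ρ ^ ((d : ℝ) - 1)) =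
      ∫ r in Ioi (0 : ℝ), ‖f r‖ ^ 2 * r ^ ((d : ℝ) - 1) := by
  set α : ℝ := ((d : ℝ) - 1) / 2 with hα
  set u : ℝ → ℂ := fun r => ((r ^ α : ℝ) : ℂ) * f r with hu
  set w : ℝ → ℂ := fun r => ((r ^ (α - (ν + 1 / 2)) * Real.exp (1 / 2 * r ^ 2) : ℝ) : ℂ) * f r
    with hw
  have hf0 : ∀ r ≤ 0, r ∉ tsupport f := fun r hr h => absurd (hsupp' h) (not_lt.mpr hr)
  have hwc : Continuous w := by
    rw [continuous_iff_continuousAt]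
    intro r
    by_cases hr : 0 < r
    · refine ContinuousAt.mul ?_ hf.continuous.continuousAt
      refine Complex.continuous_ofReal.continuousAt.comp ?_
      exact (Real.continuousAt_rpow_const _ _ (Or.inl hr.ne')).mul (by fun_prop)
    · have hev : ∀ᶠ x in nhds r, f x = 0 :=
        notMem_tsupport_iff_eventuallyEq.mp (hf0 r (not_lt.mp hr))
      refine continuousAt_const.congr (f := fun _ => (0:ℂ)) ?_
      filter_upwards [hev] with x hx
      simp [hw, hx]
  have hwsupp : HasCompactSupport w := hsupp.mul_left
  have hw0 : w 0 = 0 := by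
    have : f 0 = 0 := image_eq_zero_of_notMem_tsupport (hf0 0 le_rfl)
    simp [hw, this]
  have huw : ∀ r, 0 < r → u r = (phi ν 1 r : ℂ) * w r := by
    intro r hr
    have : r ^ α = phi ν 1 r * (r ^ (α - (ν + 1 / 2)) * Real.exp (1 / 2 * r ^ 2)) := by
      rw [phi, show r ^ (ν + 1 / 2) * Real.exp (-(1 / 2) * r ^ 2) *
        (r ^ (α - (ν + 1 / 2)) * Real.exp (1 / 2 * r ^ 2)) =
        (r ^ (ν + 1 / 2) * r ^ (α - (ν + 1 / 2))) *
        (Real.exp (-(1 / 2) * r ^ 2) * Real.exp (1 / 2 * r ^ 2)) by ring,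
        ← Real.rpow_add hr, ← Real.exp_add]
      simp
    simp only [hu, hw]
    rw [this]
    push_cast
    ring
  have hum : AEStronglyMeasurable u (volume.restrict (Ioi 0)) := by
    have := hf.continuous.measurable
    have : Measurable u := by simp only [hu]; fun_prop
    exact this.aestronglyMeasurable
  have key := hT_iso ν hν u hum (by
    intro ε hε
    obtain ⟨p, hp⟩ := exists_poly w hwc hwsupp hw0 ε hε
    refine ⟨p, fun r hr => ?_⟩
    rw [huw r hr, gP, ← mul_sub, norm_mul, Complex.norm_real,
      Real.norm_of_nonneg (phi_nonneg _ _ _ hr), mul_comm]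
    exact mul_le_mul_of_nonneg_right (hp r hr) (phi_nonneg _ _ _ hr))
  have hsq : ∀ r : ℝ, 0 < r → r ^ ((d : ℝ) - 1) = (r ^ α) ^ 2 := by
    intro r hr
    rw [← Real.rpow_natCast, ← Real.rpow_mul hr.le]
    congr 1
    simp [hα]
  have hH : ∀ ρ : ℝ, 0 < ρ → hT ν u ρ = ((ρ ^ α : ℝ) : ℂ) * hankel d ν f ρ := by
    intro ρ hρ
    rw [hT, hankel, ← integral_const_mul]
    refine setIntegral_congr_fun measurableSet_Ioi (fun r hr => ?_)
    have hr0 : (0:ℝ) < r := hr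
    have e : (r * ρ) ^ (1 / 2 : ℝ) * r ^ α =
        ρ ^ α * (r * ρ) ^ (-((d : ℝ) - 2) / 2) * r ^ ((d : ℝ) - 1) := by
      rw [hsq r hr0, show (1 / 2 : ℝ) = α + -((d : ℝ) - 2) / 2 by rw [hα]; ring,
        Real.rpow_add (by positivity), Real.mul_rpow (z := α) hr0.le hρ.le]
      ring
    have e' : (((r * ρ) ^ (1 / 2 : ℝ) : ℝ) : ℂ) * ((r ^ α : ℝ) : ℂ) = ((ρ ^ α : ℝ) : ℂ) *
        (((r * ρ) ^ (-((d : ℝ) - 2) / 2) : ℝ) : ℂ) * ((r ^ ((d : ℝ) - 1) : ℝ) : ℂ) := by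
      exact_mod_cast congrArg Complex.ofReal e
    simp only [hu, kerJ]
    linear_combination (besselJ ν (r * ρ) * f r) * e'
  rw [setIntegral_congr_fun (g := fun ρ => ‖hT ν u ρ‖ ^ 2) measurableSet_Ioi, key]
  · refine setIntegral_congr_fun measurableSet_Ioi (fun r hr => ?_)
    have hr0 : (0:ℝ) < r := hr
    simp only [hu]
    rw [norm_mul, Complex.norm_real, Real.norm_of_nonneg (by positivity), hsq r hr0]
    ring
  · intro r hr
    have hr0 : (0:ℝ) < r := hr
    simp only []
    rw [hH r hr0, norm_mul, Complex.norm_real, Real.norm_of_nonneg (by positivity), hsq r hr0]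
    ring
end
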